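/- arXiv:0910.0292 — 2 statements merged into one kernel-verified Lean document; each statement's English description precedes it below -/
import Mathlib

section
/- Let E be a row-finite directed graph and K a field. Then the Leavitt path algebra L_K(E) satisfies the ascending chain condition on two-sided ideals if and only if the hereditary saturated closures of subsets of E⁰ satisfy the ascending chain condition, i.e., every ascending chain S̄₁ ⊆ S̄₂ ⊆ ⋯ of hereditary saturated closures of subsets of E⁰ stabilizes. -/
/-- A directed graph with vertex type `V` and edge type `Ed`. -/
structure DirGraph (V Ed : Type) where
  src : Ed → V
  rng : Ed → V

variable {V Ed : Type}

/-- Generators of the Leavitt path algebra: vertices, real edges, ghost edges. -/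
abbrev LGen (V Ed : Type) : Type := V ⊕ Ed ⊕ Ed

variable (K : Type) [Field K]

/-- The vertex generator inside the free algebra. -/
def fvtx (v : V) : FreeAlgebra K (LGen V Ed) := FreeAlgebra.ι K (Sum.inl v)
/-- The real-edge generator inside the free algebra. -/
def fre (e : Ed) : FreeAlgebra K (LGen V Ed) := FreeAlgebra.ι K (Sum.inr (Sum.inl e))
/-- The ghost-edge generator inside the free algebra. -/
def fge (e : Ed) : FreeAlgebra K (LGen V Ed) := FreeAlgebra.ι K (Sum.inr (Sum.inr e))

variable (G : DirGraph V Ed)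

open scoped Classical in
/-- The defining relations of the Leavitt path algebra. -/
inductive LeavittRel : FreeAlgebra K (LGen V Ed) → FreeAlgebra K (LGen V Ed) → Prop
  | vv (v w : V) : LeavittRel (fvtx K v * fvtx K w) (if v = w then fvtx K v else 0)
  | se (e : Ed) : LeavittRel (fvtx K (G.src e) * fre K e) (fre K e)
  | er (e : Ed) : LeavittRel (fre K e * fvtx K (G.rng e)) (fre K e)
  | rg (e : Ed) : LeavittRel (fvtx K (G.rng e) * fge K e) (fge K e)
  | gs (e : Ed) : LeavittRel (fge K e * fvtx K (G.src e)) (fge K e)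
  | gf (e f : Ed) : LeavittRel (fge K e * fre K f) (if e = f then fvtx K (G.rng e) else 0)
  | ck (v : V) (hfin : {e : Ed | G.src e = v}.Finite) (hne : {e : Ed | G.src e = v}.Nonempty) :
      LeavittRel (fvtx K v) (∑ e ∈ hfin.toFinset, fre K e * fge K e)

/-- The Leavitt path algebra `L_K(E)`. -/
abbrev LPA : Type := RingQuot (LeavittRel K G)

/-- The image of a vertex in the Leavitt path algebra. -/
def vtx (v : V) : LPA K G := RingQuot.mkAlgHom K (LeavittRel K G) (fvtx K v)
/-- The image of a real edge in the Leavitt path algebra. -/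
def re (e : Ed) : LPA K G := RingQuot.mkAlgHom K (LeavittRel K G) (fre K e)
/-- The image of a ghost edge in the Leavitt path algebra. -/
def ge (e : Ed) : LPA K G := RingQuot.mkAlgHom K (LeavittRel K G) (fge K e)

/-- The element `e₁ ⋯ e_n` of the Leavitt path algebra given by a list of edges. -/
def pathProd (l : List Ed) : LPA K G := (l.map (re K G)).prod

/-- The element `μ* = e_n* ⋯ e₁*` of the Leavitt path algebra given by a list of edges. -/
def ghostStar (l : List Ed) : LPA K G := (l.reverse.map (ge K G)).prod

/-- `l` is a path from `u` to `v`: a nonempty compatible list of edges with source `u` and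
range `v`. -/
structure IsPathFromTo (G : DirGraph V Ed) (l : List Ed) (u v : V) : Prop where
  ne : l ≠ []
  chain : l.Chain' fun e f => G.rng e = G.src f
  src_eq : G.src (l.head ne) = u
  rng_eq : G.rng (l.getLast ne) = v

/-- A closed path based at `v`. -/
def IsClosedPathAt (G : DirGraph V Ed) (l : List Ed) (v : V) : Prop := IsPathFromTo G l v v

/-- A closed simple path based at `v`. -/
def IsCSPAt (G : DirGraph V Ed) (l : List Ed) (v : V) : Prop :=
  IsPathFromTo G l v v ∧ ∀ e ∈ l.tail, G.src e ≠ v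

/-- A (nontrivial) cycle based at `v`: a closed path whose sources are pairwise distinct. -/
def IsCycleListAt (G : DirGraph V Ed) (l : List Ed) (v : V) : Prop :=
  IsPathFromTo G l v v ∧ (l.map G.src).Nodup

/-- The preorder on vertices: `u ≥ v` iff `u = v` or there is a path from `u` to `v`. -/
def Reaches (G : DirGraph V Ed) (u v : V) : Prop := u = v ∨ ∃ l, IsPathFromTo G l u v

/-- `c` is (the element of `L_K(E)` given by) a possibly trivial cycle based at `v`. -/
def IsCycleElemAt (v : V) (c : LPA K G) : Prop :=
  c = vtx K G v ∨ ∃ l, IsCycleListAt G l v ∧ c = pathProd K G l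

/-- `x` has the form `v + ∑_{k=1}^m λ_k g^k` for a (possibly trivial) cycle `g` based at `v`. -/
def IsCycleGenElt (x : LPA K G) : Prop :=
  ∃ (v : V) (c : LPA K G), IsCycleElemAt K G v c ∧ ∃ (m : ℕ) (lam : ℕ → K),
    x = vtx K G v + ∑ k ∈ Finset.range m, lam (k + 1) • c ^ (k + 1)

/-- A hereditary subset of vertices. -/
def Hereditary (G : DirGraph V Ed) (H : Set V) : Prop :=
  ∀ u ∈ H, ∀ v, Reaches G u v → v ∈ H

/-- A saturated subset of vertices. -/
def Saturated (G : DirGraph V Ed) (H : Set V) : Prop :=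
  ∀ v : V, ({e : Ed | G.src e = v}).Finite → ({e : Ed | G.src e = v}).Nonempty →
    (∀ e : Ed, G.src e = v → G.rng e ∈ H) → v ∈ H

/-- The hereditary saturated closure of a set of vertices. -/
def HSClosure (G : DirGraph V Ed) (X : Set V) : Set V :=
  ⋂₀ {H : Set V | X ⊆ H ∧ Hereditary G H ∧ Saturated G H}


namespace LPA
variable {K G}

theorem vtx_mul_vtx_self (v : V) : vtx K G v * vtx K G v = vtx K G v := by
  have := RingQuot.mkAlgHom_rel K (LeavittRel.vv (K := K) (G := G) v v)
  simpa [vtx] using this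

theorem vtx_mul_vtx_of_ne {v w : V} (h : v ≠ w) : vtx K G v * vtx K G w = 0 := by
  have := RingQuot.mkAlgHom_rel K (LeavittRel.vv (K := K) (G := G) v w)
  simpa [vtx, h] using this

theorem vtx_src_mul_re (e : Ed) : vtx K G (G.src e) * re K G e = re K G e := by
  simpa [vtx, re] using RingQuot.mkAlgHom_rel K (LeavittRel.se (K := K) (G := G) e)

theorem re_mul_vtx_rng (e : Ed) : re K G e * vtx K G (G.rng e) = re K G e := by
  simpa [vtx, re] using RingQuot.mkAlgHom_rel K (LeavittRel.er (K := K) (G := G) e)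

theorem vtx_rng_mul_ge (e : Ed) : vtx K G (G.rng e) * ge K G e = ge K G e := by
  simpa [vtx, ge] using RingQuot.mkAlgHom_rel K (LeavittRel.rg (K := K) (G := G) e)

theorem ge_mul_vtx_src (e : Ed) : ge K G e * vtx K G (G.src e) = ge K G e := by
  simpa [vtx, ge] using RingQuot.mkAlgHom_rel K (LeavittRel.gs (K := K) (G := G) e)

theorem ge_mul_re_self (e : Ed) : ge K G e * re K G e = vtx K G (G.rng e) := by
  simpa [vtx, ge, re] using RingQuot.mkAlgHom_rel K (LeavittRel.gf (K := K) (G := G) e e)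

theorem ge_mul_re_of_ne {e f : Ed} (h : e ≠ f) : ge K G e * re K G f = 0 := by
  simpa [vtx, ge, re, h] using RingQuot.mkAlgHom_rel K (LeavittRel.gf (K := K) (G := G) e f)

theorem vtx_eq_sum {v : V} (hfin : {e : Ed | G.src e = v}.Finite)
    (hne : {e : Ed | G.src e = v}.Nonempty) :
    vtx K G v = ∑ e ∈ hfin.toFinset, re K G e * ge K G e := by
  simpa [vtx, ge, re] using RingQuot.mkAlgHom_rel K (LeavittRel.ck (K := K) (G := G) v hfin hne)

theorem vtx_mul_re_of_ne {v : V} {e : Ed} (h : v ≠ G.src e) : vtx K G v * re K G e = 0 := by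
  rw [← vtx_src_mul_re, ← mul_assoc, vtx_mul_vtx_of_ne h, zero_mul]

theorem ge_mul_vtx_of_ne {v : V} {e : Ed} (h : G.src e ≠ v) : ge K G e * vtx K G v = 0 := by
  rw [← ge_mul_vtx_src, mul_assoc, vtx_mul_vtx_of_ne h, mul_zero]

/-- `Trail G u l w`: the possibly empty list of edges `l` is a path from `u` to `w`. -/
inductive Trail (G : DirGraph V Ed) : V → List Ed → V → Prop
  | nil (v : V) : Trail G v [] v
  | cons (e : Ed) {l : List Ed} {w : V} (h : Trail G (G.rng e) l w) :
      Trail G (G.src e) (e :: l) w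

namespace Trail

theorem cons_iff {u w : V} {e : Ed} {l : List Ed} :
    Trail G u (e :: l) w ↔ G.src e = u ∧ Trail G (G.rng e) l w := by
  constructor
  · rintro ⟨⟩
    exact ⟨rfl, ‹_›⟩
  · rintro ⟨rfl, h⟩
    exact .cons e h

theorem nil_iff {u w : V} : Trail G u [] w ↔ u = w := by
  constructor
  · rintro ⟨⟩
    rfl
  · rintro rfl
    exact .nil u

theorem append {u v w : V} {l l' : List Ed} (h : Trail G u l v) (h' : Trail G v l' w) :
    Trail G u (l ++ l') w := by
  induction h with
  | nil => exact h'
  | cons e _ ih => exact .cons e (ih h')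

theorem rng_unique {u v w : V} {l : List Ed} (h : Trail G u l v) (h' : Trail G u l w) :
    v = w := by
  induction h with
  | nil => exact nil_iff.1 h'
  | cons e _ ih => exact ih (cons_iff.1 h').2

theorem exists_of_append {u w : V} {l l' : List Ed} (h : Trail G u (l ++ l') w) :
    ∃ v, Trail G u l v ∧ Trail G v l' w := by
  induction l generalizing u with
  | nil => exact ⟨u, .nil u, h⟩
  | cons e l ih =>
    obtain ⟨rfl, h'⟩ := cons_iff.1 h
    obtain ⟨v, h1, h2⟩ := ih h'
    exact ⟨v, .cons e h1, h2⟩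

theorem of_append {u v w : V} {l l' : List Ed} (h : Trail G u (l ++ l') w)
    (hl : Trail G u l v) : Trail G v l' w := by
  obtain ⟨v', h1, h2⟩ := exists_of_append h
  rwa [hl.rng_unique h1]

end Trail

theorem isPathFromTo_iff {u w : V} {l : List Ed} :
    IsPathFromTo G l u w ↔ l ≠ [] ∧ Trail G u l w := by
  induction l generalizing u with
  | nil => exact ⟨fun h => absurd rfl h.ne, fun h => absurd rfl h.1⟩
  | cons e l ih =>
    rcases l with _ | ⟨f, l⟩
    · constructor
      · rintro ⟨_, _, h1, h2⟩
        exact ⟨by simp, Trail.cons_iff.2 ⟨h1, Trail.nil_iff.2 h2⟩⟩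
      · rintro ⟨-, h⟩
        obtain ⟨h1, h2⟩ := Trail.cons_iff.1 h
        exact ⟨by simp, List.isChain_singleton _, h1, Trail.nil_iff.1 h2⟩
    · rw [Trail.cons_iff]
      constructor
      · rintro ⟨_, h, h1, h2⟩
        obtain ⟨h3, h4⟩ := List.isChain_cons_cons.1 h
        exact ⟨by simp, h1, (ih.1 ⟨by simp, h4, h3.symm, by simpa using h2⟩).2⟩
      · rintro ⟨-, h1, h⟩
        obtain ⟨h2, h3, h4, h5⟩ := ih.2 ⟨by simp, h⟩
        exact ⟨by simp, List.isChain_cons_cons.2 ⟨h4.symm, h3⟩, h1, by simpa using h5⟩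

theorem reaches_iff {u w : V} : Reaches G u w ↔ ∃ l, Trail G u l w := by
  constructor
  · rintro (rfl | ⟨l, h⟩)
    · exact ⟨[], .nil u⟩
    · exact ⟨l, (isPathFromTo_iff.1 h).2⟩
  · rintro ⟨l, h⟩
    rcases eq_or_ne l [] with rfl | hl
    · exact Or.inl (Trail.nil_iff.1 h)
    · exact Or.inr ⟨l, isPathFromTo_iff.2 ⟨hl, h⟩⟩

theorem hereditary_iff {H : Set V} :
    Hereditary G H ↔ ∀ e, G.src e ∈ H → G.rng e ∈ H := by
  constructor
  · intro h e he
    exact h _ he _ (reaches_iff.2 ⟨[e], .cons e (.nil _)⟩)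
  · intro h u hu v huv
    obtain ⟨l, hl⟩ := reaches_iff.1 huv
    clear huv
    induction hl with
    | nil => exact hu
    | cons e _ ih => exact ih (h e hu)

theorem subset_hsClosure (X : Set V) : X ⊆ HSClosure G X :=
  Set.subset_sInter fun _ h => h.1

theorem hsClosure_subset {X H : Set V} (h : X ⊆ H) (hH : Hereditary G H) (hs : Saturated G H) :
    HSClosure G X ⊆ H :=
  Set.sInter_subset_of_mem ⟨h, hH, hs⟩

theorem hsClosure_eq_self {H : Set V} (hH : Hereditary G H) (hs : Saturated G H) :
    HSClosure G H = H :=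
  (hsClosure_subset subset_rfl hH hs).antisymm (subset_hsClosure H)

theorem hereditary_hsClosure (X : Set V) : Hereditary G (HSClosure G X) :=
  fun u hu v huv _ hH => hH.2.1 u (hu _ hH) v huv

theorem saturated_hsClosure (X : Set V) : Saturated G (HSClosure G X) :=
  fun v hf hn h _ hH => hH.2.2 v hf hn fun e he => h e he _ hH

theorem hsClosure_mono {X Y : Set V} (h : X ⊆ Y) : HSClosure G X ⊆ HSClosure G Y :=
  hsClosure_subset (h.trans (subset_hsClosure Y)) (hereditary_hsClosure Y) (saturated_hsClosure Y)

/-- The vertices lying in a two-sided ideal. -/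
def idealVertices (I : TwoSidedIdeal (LPA K G)) : Set V := {v | vtx K G v ∈ I}

theorem hereditary_idealVertices (I : TwoSidedIdeal (LPA K G)) :
    Hereditary G (idealVertices I) := by
  refine hereditary_iff.2 fun e he => ?_
  have h : vtx K G (G.rng e) = ge K G e * vtx K G (G.src e) * re K G e := by
    rw [ge_mul_vtx_src, ge_mul_re_self]
  change vtx K G (G.rng e) ∈ I
  rw [h]
  exact I.mul_mem_right _ _ (I.mul_mem_left _ _ he)

theorem saturated_idealVertices (I : TwoSidedIdeal (LPA K G)) :
    Saturated G (idealVertices I) := by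
  intro v hf hn h
  change vtx K G v ∈ I
  rw [vtx_eq_sum hf hn]
  refine sum_mem fun e he => ?_
  rw [← re_mul_vtx_rng]
  exact I.mul_mem_right _ _ (I.mul_mem_left _ _ (h e (by simpa using he)))

@[simp]
theorem pathProd_nil : pathProd K G [] = 1 := rfl

theorem pathProd_cons (e : Ed) (l : List Ed) :
    pathProd K G (e :: l) = re K G e * pathProd K G l := by simp [pathProd]

theorem pathProd_append (l l' : List Ed) :
    pathProd K G (l ++ l') = pathProd K G l * pathProd K G l' := by simp [pathProd]

@[simp]
theorem ghostStar_nil : ghostStar K G [] = 1 := rfl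

theorem ghostStar_cons (e : Ed) (l : List Ed) :
    ghostStar K G (e :: l) = ghostStar K G l * ge K G e := by simp [ghostStar]

/-- The element of the Leavitt path algebra given by a possibly empty path starting at `u`. -/
def trailElt (u : V) (l : List Ed) : LPA K G := vtx K G u * pathProd K G l

theorem trailElt_nil (u : V) : trailElt (K := K) (G := G) u [] = vtx K G u := by
  simp [trailElt]

theorem trailElt_cons (e : Ed) (l : List Ed) :
    trailElt (K := K) (G := G) (G.src e) (e :: l) = re K G e * trailElt (G.rng e) l := by
  rw [trailElt, trailElt, pathProd_cons, ← mul_assoc, ← mul_assoc, vtx_src_mul_re,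
    re_mul_vtx_rng]

theorem vtx_mul_trailElt (u : V) (l : List Ed) :
    vtx K G u * trailElt u l = trailElt u l := by
  rw [trailElt, ← mul_assoc, vtx_mul_vtx_self]

theorem trailElt_mul_vtx {u w : V} {l : List Ed} (h : Trail G u l w) :
    trailElt u l * vtx K G w = trailElt u l := by
  induction h with
  | nil => rw [trailElt_nil, vtx_mul_vtx_self]
  | cons e _ ih => rw [trailElt_cons, mul_assoc, ih]

theorem trailElt_append {u v : V} {l : List Ed} (h : Trail G u l v) (l' : List Ed) :
    trailElt (K := K) (G := G) u (l ++ l') = trailElt u l * trailElt v l' := by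
  conv_rhs => rw [trailElt.eq_def v, ← mul_assoc, trailElt_mul_vtx h]
  rw [trailElt, trailElt, pathProd_append, mul_assoc]

theorem trailElt_mul_vtx_of_not_trail {u w : V} {l : List Ed} (h : ¬ Trail G u l w) :
    trailElt u l * vtx K G w = 0 := by
  induction l generalizing u with
  | nil => rw [trailElt_nil, vtx_mul_vtx_of_ne (fun h' => h (Trail.nil_iff.2 h'))]
  | cons e l ih =>
    by_cases hu : u = G.src e
    · subst hu
      rw [trailElt_cons, mul_assoc, ih (fun h' => h (.cons e h')), mul_zero]
    · rw [trailElt, pathProd_cons, ← mul_assoc, vtx_mul_re_of_ne hu, zero_mul, zero_mul]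

theorem ghostStar_mul_trailElt_append {u v : V} {l : List Ed} (h : Trail G u l v)
    (l' : List Ed) : ghostStar K G l * trailElt u (l ++ l') = trailElt v l' := by
  induction h with
  | nil => simp
  | cons e _ ih =>
    rw [List.cons_append, trailElt_cons, ghostStar_cons, mul_assoc, ← mul_assoc (ge K G e),
      ge_mul_re_self, vtx_mul_trailElt, ih]

theorem ghostStar_mul_trailElt_self {u v : V} {l : List Ed} (h : Trail G u l v) :
    ghostStar K G l * trailElt u l = vtx K G v := by
  simpa [trailElt_nil] using ghostStar_mul_trailElt_append (K := K) h []

theorem ghostStar_mul_trailElt_eq_zero {u w : V} {l l' : List Ed} (h : Trail G u l' w)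
    (hl : ¬ l <+: l') (hlen : l.length ≤ l'.length) :
    ghostStar K G l * trailElt u l' = 0 := by
  induction l generalizing u l' with
  | nil => exact absurd (List.nil_prefix) hl
  | cons e l ih =>
    rcases h with _ | ⟨f, h⟩
    · simp at hlen
    · rw [trailElt_cons, ghostStar_cons, mul_assoc, ← mul_assoc (ge K G e)]
      by_cases hef : e = f
      · subst hef
        rw [ge_mul_re_self, vtx_mul_trailElt]
        exact ih h (fun h' => hl (by simpa using h')) (by simpa using hlen)
      · rw [ge_mul_re_of_ne hef, zero_mul, mul_zero]


theorem smul_mem_ideal (I : TwoSidedIdeal (LPA K G)) (c : K) {x : LPA K G} (hx : x ∈ I) :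
    c • x ∈ I := by
  rw [Algebra.smul_def]
  exact I.mul_mem_left _ _ hx

theorem of_smul_mem_ideal (I : TwoSidedIdeal (LPA K G)) {c : K} (hc : c ≠ 0) {x : LPA K G}
    (hx : c • x ∈ I) : x ∈ I := by
  simpa [smul_smul, hc] using smul_mem_ideal I c⁻¹ hx

theorem prefix_flatten_replicate {α τ : List Ed} (hα : α ≠ []) (h : τ <+: α ++ τ) {n : ℕ}
    (hn : τ.length ≤ n) : τ <+: (List.replicate n α).flatten := by
  have key : ∀ n : ℕ, τ <+: (List.replicate n α).flatten ++ τ := by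
    intro n
    induction n with
    | zero => simp
    | succ n ih =>
      rw [List.replicate_succ, List.flatten_cons, List.append_assoc]
      exact h.trans ((List.prefix_append_right_inj α).2 ih)
  refine List.prefix_of_prefix_length_le (key n) (List.prefix_append _ _) ?_
  have : 1 ≤ α.length := List.length_pos_iff.2 hα
  simp only [List.length_flatten, List.map_replicate, List.sum_replicate, smul_eq_mul]
  nlinarith

theorem trail_flatten_replicate {u : V} {α : List Ed} (h : Trail G u α u) (n : ℕ) :
    Trail G u (List.replicate n α).flatten u := by
  induction n with
  | zero => exact .nil u
  | succ n ih =>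
    rw [List.replicate_succ, List.flatten_cons]
    exact h.append ih

/-- A vertex outside `H` is rigid if it lies on a closed path and the paths starting at it and
staying outside `H` are prefixes of one another: it lies on a cycle without exits modulo `H`. -/
structure Rigid (G : DirGraph V Ed) (H : Set V) (u : V) : Prop where
  notMem : u ∉ H
  exists_closed : ∃ l, l ≠ [] ∧ Trail G u l u
  comparable : ∀ {l l' : List Ed} {w w' : V}, Trail G u l w → w ∉ H → Trail G u l' w' → w' ∉ H →
    l <+: l' ∨ l' <+: l

/-- A linear combination of path elements starting at `u`. -/
def trailComb (u : V) (L : List (K × List Ed)) : LPA K G :=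
  (L.map fun p => p.1 • trailElt u p.2).sum

open scoped Classical in
/-- The effect on the closed path `α` of conjugation by the path `η`. -/
noncomputable def conjTrail {R : Type} (η : List Ed) (p : R × List Ed) : Option (R × List Ed) :=
  if η <+: p.2 ++ η then some (p.1, (p.2 ++ η).drop η.length) else none

theorem conjTrail_trail {R : Type} {u v : V} {η : List Ed} (hη : Trail G u η v) {p q : R × List Ed}
    (hp : Trail G u p.2 u) (h : conjTrail η p = some q) : Trail G v q.2 v := by
  unfold conjTrail at h
  split_ifs at h with hpre
  cases h
  obtain ⟨γ, hγ⟩ := hpre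
  simp only [← hγ, List.drop_left]
  exact (hγ ▸ hp.append hη : Trail G u (η ++ γ) v).of_append hη

theorem conjTrail_ne_nil {R : Type} {η : List Ed} {p q : R × List Ed} (hp : p.2 ≠ [])
    (h : conjTrail η p = some q) : q.2 ≠ [] := by
  unfold conjTrail at h
  split_ifs at h with hpre
  cases h
  have := List.length_pos_iff.2 hp
  apply List.ne_nil_of_length_pos
  simp only [List.length_drop, List.length_append]
  omega

theorem conj_trailComb {u v : V} {η : List Ed} (hη : Trail G u η v) (L : List (K × List Ed))
    (hL : ∀ p ∈ L, Trail G u p.2 u) :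
    ghostStar K G η * trailComb u L * trailElt u η = trailComb v (L.filterMap (conjTrail η)) := by
  induction L with
  | nil => simp [trailComb]
  | cons p L ih =>
    have hp : Trail G u p.2 u := hL p (by simp)
    have ih' := ih fun q hq => hL q (by simp [hq])
    have hcons : trailComb (G := G) u (p :: L) = p.1 • trailElt u p.2 + trailComb u L := by
      simp [trailComb]
    rw [hcons, mul_add, add_mul, ih', mul_smul_comm, smul_mul_assoc, mul_assoc,
      ← trailElt_append hp]
    by_cases h : η <+: p.2 ++ η
    · have hc : conjTrail η p = some (p.1, (p.2 ++ η).drop η.length) := by simp [conjTrail, h]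
      rw [List.filterMap_cons_some hc]
      obtain ⟨γ, hγ⟩ := h
      rw [← hγ, ghostStar_mul_trailElt_append hη, List.drop_left]
      simp [trailComb]
    · have hc : conjTrail η p = none := by simp [conjTrail, h]
      rw [List.filterMap_cons_none hc, ghostStar_mul_trailElt_eq_zero (hp.append hη) h
        (by simp), smul_zero, zero_add]

theorem conj_smul_vtx_add {u v : V} {η : List Ed} (hη : Trail G u η v) (c : K) (x : LPA K G) :
    ghostStar K G η * (c • vtx K G u + x) * trailElt u η =
      c • vtx K G v + ghostStar K G η * x * trailElt u η := by
  rw [mul_add, add_mul, mul_smul_comm, smul_mul_assoc, mul_assoc, vtx_mul_trailElt,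
    ghostStar_mul_trailElt_self hη]

/-- An ideal containing a nonzero multiple of a vertex `u` plus closed paths at `u`, but not `u`,
forces `u` to be rigid. -/
theorem rigid_of_mem (I : TwoSidedIdeal (LPA K G)) {u : V} (hu : u ∉ idealVertices I) {c : K}
    (hc : c ≠ 0) (L : List (K × List Ed)) (hL : ∀ p ∈ L, p.2 ≠ [] ∧ Trail G u p.2 u)
    (h : c • vtx K G u + trailComb u L ∈ I) : Rigid G (idealVertices I) u := by
  induction hn : L.length using Nat.strong_induction_on generalizing L with
  | _ n ih =>
  subst hn
  have hconj : ∀ {v : V} {η : List Ed}, Trail G u η v →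
      c • vtx K G v + trailComb v (L.filterMap (conjTrail η)) ∈ I := by
    intro v η hη
    rw [← conj_trailComb hη L fun p hp => (hL p hp).2, ← conj_smul_vtx_add hη]
    exact I.mul_mem_right _ _ (I.mul_mem_left _ _ h)
  by_cases hall : ∀ p ∈ L, ∀ η, Trail G u η u → η <+: p.2 ++ η
  · rcases L.eq_nil_or_concat with rfl | ⟨L', p, hLp⟩
    · exact absurd (of_smul_mem_ideal I hc (by simpa [trailComb] using h)) hu
    have hp : p ∈ L := by simp [hLp]
    have hpre : ∀ {τ : List Ed} {w : V}, Trail G u τ w → w ∉ idealVertices I →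
        τ <+: p.2 ++ τ := by
      intro τ w hτ hw
      by_contra hcon
      apply hw
      have hnil : L.filterMap (conjTrail τ) = [] := by
        rw [List.filterMap_eq_nil_iff]
        intro q hq
        have : ¬ τ <+: q.2 ++ τ := by
          intro hq'
          apply hcon
          have h1 := prefix_flatten_replicate (hL q hq).1 hq' le_rfl
          have h2 := hall p hp _ (trail_flatten_replicate (hL q hq).2 τ.length)
          exact List.prefix_of_prefix_length_le (h1.trans h2)
            ((List.prefix_append_right_inj p.2).2 h1) (by simp)
        simp [conjTrail, this]
      refine of_smul_mem_ideal I hc ?_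
      simpa [hnil, trailComb] using hconj hτ
    refine ⟨hu, ⟨p.2, hL p hp⟩, ?_⟩
    intro l l' w w' hl hw hl' hw'
    exact List.prefix_or_prefix_of_prefix
      (prefix_flatten_replicate (hL p hp).1 (hpre hl hw) (le_max_left l.length l'.length))
      (prefix_flatten_replicate (hL p hp).1 (hpre hl' hw') (le_max_right l.length l'.length))
  · push Not at hall
    obtain ⟨p, hp, η, hη, hnot⟩ := hall
    refine ih _ ?_ (L.filterMap (conjTrail η)) ?_ (hconj hη) rfl
    · refine List.length_filterMap_lt_length_iff_exists.2 ⟨p, hp, ?_⟩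
      simp [conjTrail, hnot]
    · intro q hq
      obtain ⟨r, hr, hrq⟩ := List.mem_filterMap.1 hq
      exact ⟨conjTrail_ne_nil (hL r hr).1 hrq, conjTrail_trail hη (hL r hr).2 hrq⟩


theorem trailComb_cons (u : V) (p : K × List Ed) (L : List (K × List Ed)) :
    trailComb (G := G) u (p :: L) = p.1 • trailElt u p.2 + trailComb u L := by
  simp [trailComb]

theorem vtx_mul_trailComb (u : V) (L : List (K × List Ed)) :
    vtx K G u * trailComb u L = trailComb u L := by
  induction L with
  | nil => simp [trailComb]
  | cons p L ih => rw [trailComb_cons, mul_add, mul_smul_comm, vtx_mul_trailElt, ih]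

theorem trailComb_mul_vtx {u w : V} {L : List (K × List Ed)} (hL : ∀ p ∈ L, Trail G u p.2 w) :
    trailComb u L * vtx K G w = trailComb u L := by
  induction L with
  | nil => simp [trailComb]
  | cons p L ih =>
    rw [trailComb_cons, add_mul, smul_mul_assoc, trailElt_mul_vtx (hL p (by simp)),
      ih fun q hq => hL q (by simp [hq])]

theorem exists_trailComb_eq_smul_add {u w : V} (L : List (K × List Ed))
    (hL : ∀ p ∈ L, Trail G u p.2 w) :
    ∃ (c : K) (L' : List (K × List Ed)), (c ≠ 0 → u = w) ∧ (∀ p ∈ L', p ∈ L ∧ p.2 ≠ []) ∧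
      trailComb u L = c • vtx K G u + trailComb u L' := by
  induction L with
  | nil => exact ⟨0, [], by simp, by simp, by simp⟩
  | cons p L ih =>
    obtain ⟨c, L', hc, hL', h⟩ := ih fun q hq => hL q (by simp [hq])
    by_cases hp : p.2 = []
    · have huw : u = w := Trail.nil_iff.1 (hp ▸ hL p (by simp))
      refine ⟨p.1 + c, L', fun _ => huw, fun q hq => ⟨by simp [hL' q hq], (hL' q hq).2⟩, ?_⟩
      rw [trailComb_cons, h, hp, trailElt_nil, add_smul, add_assoc]
    · refine ⟨c, p :: L', hc, ?_, ?_⟩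
      · intro q hq
        rcases List.mem_cons.1 hq with rfl | hq
        · exact ⟨by simp, hp⟩
        · exact ⟨by simp [hL' q hq], (hL' q hq).2⟩
      · rw [trailComb_cons, trailComb_cons, h]
        abel

theorem exists_ge_mul_trailComb {e : Ed} {w : V} (L : List (K × List Ed))
    (hL : ∀ p ∈ L, p.2 ≠ [] ∧ Trail G (G.src e) p.2 w) :
    ∃ L' : List (K × List Ed), (∀ q ∈ L', ∃ p ∈ L, p.2 = e :: q.2) ∧
      ge K G e * trailComb (G.src e) L = trailComb (G.rng e) L' := by
  induction L with
  | nil => exact ⟨[], by simp, by simp [trailComb]⟩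
  | cons p L ih =>
    obtain ⟨L', hL', h⟩ := ih fun q hq => hL q (by simp [hq])
    obtain ⟨hp, hp'⟩ := hL p (by simp)
    obtain ⟨c, l⟩ := p
    obtain _ | ⟨f, l⟩ := l
    · simp at hp
    rw [trailComb_cons, mul_add, h]
    by_cases hef : e = f
    · subst hef
      refine ⟨(c, l) :: L', ?_, ?_⟩
      · intro q hq
        rcases List.mem_cons.1 hq with rfl | hq
        · exact ⟨(c, e :: l), by simp, rfl⟩
        · obtain ⟨p, hp, hpq⟩ := hL' q hq
          exact ⟨p, by simp [hp], hpq⟩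
      · rw [trailComb_cons, trailElt_cons, mul_smul_comm, ← mul_assoc, ge_mul_re_self,
          vtx_mul_trailElt]
    · refine ⟨L', ?_, ?_⟩
      · intro q hq
        obtain ⟨p, hp, hpq⟩ := hL' q hq
        exact ⟨p, by simp [hp], hpq⟩
      · rw [trailElt, pathProd_cons, mul_smul_comm, ← mul_assoc, ← mul_assoc, ge_mul_vtx_src,
          ge_mul_re_of_ne hef, zero_mul, smul_zero, zero_add]

theorem Trail.mem_of_hereditary {H : Set V} (hH : Hereditary G H) {u w : V} {l : List Ed}
    (h : Trail G u l w) (hu : u ∈ H) : w ∈ H :=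
  hH u hu w (reaches_iff.2 ⟨l, h⟩)

theorem vtx_sub_mem (hrow : ∀ v : V, {e : Ed | G.src e = v}.Finite)
    (J : TwoSidedIdeal (LPA K G)) {u v : V} {η : List Ed} (hη : Trail G u η v)
    (hv : v ∉ idealVertices J)
    (hcomp : ∀ {l l' : List Ed} {w w' : V}, Trail G u l w → w ∉ idealVertices J →
      Trail G u l' w' → w' ∉ idealVertices J → l <+: l' ∨ l' <+: l) :
    vtx K G u - trailElt u η * ghostStar K G η ∈ J := by
  classical
  induction hη with
  | nil => simp [trailElt_nil, J.zero_mem]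
  | @cons e l w hl ih =>
    have hre : G.rng e ∉ idealVertices J :=
      fun h => hv (hl.mem_of_hereditary (hereditary_idealVertices J) h)
    have h1 : vtx K G (G.src e) - re K G e * ge K G e ∈ J := by
      rw [vtx_eq_sum (hrow (G.src e)) ⟨e, rfl⟩,
        ← Finset.sum_erase_add _ _ (show e ∈ (hrow (G.src e)).toFinset by simp), add_sub_cancel_right]
      refine sum_mem fun f hf => ?_
      simp only [Finset.mem_erase, Set.Finite.mem_toFinset, Set.mem_ofPred_eq] at hf
      have hrf : G.rng f ∈ idealVertices J := by
        by_contra hrf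
        have hf' : Trail G (G.src e) [f] (G.rng f) := Trail.cons_iff.2 ⟨hf.2, .nil _⟩
        rcases hcomp (.cons e (.nil _)) hre hf' hrf with h | h
        · simp at h
          exact hf.1 h.symm
        · simp at h
          exact hf.1 h
      rw [← re_mul_vtx_rng]
      exact J.mul_mem_right _ _ (J.mul_mem_left _ _ hrf)
    have h2 := ih hv fun {l l' w w'} h hw h' hw' => by
      simpa using hcomp (.cons e h) hw (.cons e h') hw'
    have h3 : vtx K G (G.src e) - trailElt (G.src e) (e :: l) * ghostStar K G (e :: l) =
        (vtx K G (G.src e) - re K G e * ge K G e) +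
        re K G e * (vtx K G (G.rng e) - trailElt (G.rng e) l * ghostStar K G l) * ge K G e := by
      rw [trailElt_cons, ghostStar_cons, mul_sub, re_mul_vtx_rng, sub_mul]
      simp only [mul_assoc]
      abel
    rw [h3]
    exact J.add_mem h1 (J.mul_mem_right _ _ (J.mul_mem_left _ _ h2))

/-- Sufficient conditions for `I` and `J` to have the same linear combinations of paths. -/
structure SameCycles (I J : TwoSidedIdeal (LPA K G)) (F : Set V) : Prop where
  vertices : idealVertices I = idealVertices J
  rigid_reaches : ∀ u, Rigid G (idealVertices I) u → ∃ v ∈ F, ∃ l, Trail G u l v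
  notMem : ∀ v ∈ F, v ∉ idealVertices I
  closed_mem : ∀ v ∈ F, ∀ L : List (K × List Ed), (∀ p ∈ L, Trail G v p.2 v) →
    trailComb v L ∈ I → trailComb v L ∈ J

namespace SameCycles

variable {I J : TwoSidedIdeal (LPA K G)} {F : Set V}

theorem mem_of_rigid (hrow : ∀ v : V, {e : Ed | G.src e = v}.Finite) (h : SameCycles I J F)
    {u : V} (hu : Rigid G (idealVertices I) u) {L : List (K × List Ed)}
    (hL : ∀ p ∈ L, Trail G u p.2 u) (hI : trailComb u L ∈ I) : trailComb u L ∈ J := by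
  obtain ⟨v, hv, η, hη⟩ := h.rigid_reaches u hu
  have hsub : vtx K G u - trailElt u η * ghostStar K G η ∈ J := by
    refine vtx_sub_mem hrow J hη (h.vertices ▸ h.notMem v hv) ?_
    rw [← h.vertices]
    exact hu.comparable
  have hconj : ghostStar K G η * trailComb u L * trailElt u η ∈ J := by
    have hI' : ghostStar K G η * trailComb u L * trailElt u η ∈ I :=
      I.mul_mem_right _ _ (I.mul_mem_left _ _ hI)
    rw [conj_trailComb hη L hL] at hI' ⊢
    refine h.closed_mem v hv _ ?_ hI'
    intro q hq
    obtain ⟨r, hr, hrq⟩ := List.mem_filterMap.1 hq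
    exact conjTrail_trail hη (hL r hr) hrq
  have key : trailComb u L =
      (vtx K G u - trailElt u η * ghostStar K G η) * trailComb u L +
      trailElt u η * ghostStar K G η * trailComb u L *
        (vtx K G u - trailElt u η * ghostStar K G η) +
      trailElt u η * (ghostStar K G η * trailComb u L * trailElt u η) * ghostStar K G η := by
    rw [sub_mul, mul_sub, vtx_mul_trailComb]
    simp only [mul_assoc]
    rw [trailComb_mul_vtx hL]
    abel
  rw [key]
  exact J.add_mem (J.add_mem (J.mul_mem_right _ _ hsub) (J.mul_mem_left _ _ hsub))
    (J.mul_mem_right _ _ (J.mul_mem_left _ _ hconj))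

theorem trailComb_mem (hrow : ∀ v : V, {e : Ed | G.src e = v}.Finite) (h : SameCycles I J F)
    (n : ℕ) {u w : V} {L : List (K × List Ed)}
    (hL : ∀ p ∈ L, Trail G u p.2 w ∧ p.2.length ≤ n) (hI : trailComb u L ∈ I) :
    trailComb u L ∈ J := by
  induction n generalizing u L with
  | zero =>
    by_cases hu : u ∈ idealVertices I
    · rw [h.vertices] at hu
      rw [← vtx_mul_trailComb]
      exact J.mul_mem_right _ _ hu
    obtain ⟨c, L', hc, hL', heq⟩ := exists_trailComb_eq_smul_add L fun p hp => (hL p hp).1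
    have hnil : L' = [] := by
      refine List.eq_nil_iff_forall_not_mem.2 fun p hp => (hL' p hp).2 ?_
      simpa using (hL p (hL' p hp).1).2
    subst hnil
    rw [heq] at hI ⊢
    by_cases hc0 : c = 0
    · simp [hc0, trailComb, J.zero_mem]
    · exact absurd (of_smul_mem_ideal I hc0 (by simpa [trailComb] using hI)) hu
  | succ n ih =>
    by_cases hu : u ∈ idealVertices I
    · rw [h.vertices] at hu
      rw [← vtx_mul_trailComb]
      exact J.mul_mem_right _ _ hu
    obtain ⟨c, L', hc, hL', heq⟩ := exists_trailComb_eq_smul_add L fun p hp => (hL p hp).1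
    by_cases hc0 : c = 0
    · rw [heq, hc0, zero_smul, zero_add] at hI ⊢
      rcases L'.eq_nil_or_concat with hnil | ⟨L'', p, hLp⟩
      · simp [hnil, trailComb, J.zero_mem]
      have hp : p ∈ L' := by simp [hLp]
      have hne : {e : Ed | G.src e = u}.Nonempty := by
        have h1 := (hL p (hL' p hp).1).1
        have h2 := (hL' p hp).2
        obtain ⟨c, l⟩ := p
        obtain _ | ⟨f, l⟩ := l
        · exact absurd rfl h2
        · exact ⟨f, (Trail.cons_iff.1 h1).1⟩
      rw [← vtx_mul_trailComb, vtx_eq_sum (hrow u) hne, Finset.sum_mul]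
      refine sum_mem fun e he => ?_
      have he' : G.src e = u := by simpa using he
      subst he'
      rw [mul_assoc]
      refine J.mul_mem_left _ _ ?_
      obtain ⟨L₁, hL₁, heq₁⟩ := exists_ge_mul_trailComb (K := K) (e := e) (w := w) L'
        fun p hp => ⟨(hL' p hp).2, (hL p (hL' p hp).1).1⟩
      have hI' := I.mul_mem_left (ge K G e) _ hI
      rw [heq₁] at hI' ⊢
      refine ih (fun q hq => ?_) hI'
      obtain ⟨p, hp, hpq⟩ := hL₁ q hq
      obtain ⟨h1, h2⟩ := hL p (hL' p hp).1
      rw [hpq] at h1 h2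
      exact ⟨(Trail.cons_iff.1 h1).2, by simpa using h2⟩
    · obtain rfl := hc hc0
      refine h.mem_of_rigid hrow ?_ (fun p hp => (hL p hp).1) hI
      rw [heq] at hI
      exact rigid_of_mem I hu hc0 L' (fun p hp => ⟨(hL' p hp).2, (hL p (hL' p hp).1).1⟩) hI

end SameCycles


variable (K G) in
/-- The span of the elements `μ ν*` with `μ` a path and `ν` a list of at most `n` edges. -/
def pathSpan : ℕ → Submodule K (LPA K G)
  | 0 => Submodule.span K (Set.range fun p : V × List Ed => trailElt p.1 p.2)
  | n + 1 => Submodule.span K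
      ({x | x ∈ pathSpan n} ∪ {x | ∃ (e : Ed) (y : LPA K G), y ∈ pathSpan n ∧ x = y * ge K G e})

theorem trailElt_mem_pathSpan (u : V) (l : List Ed) : trailElt u l ∈ pathSpan K G 0 :=
  Submodule.subset_span ⟨(u, l), rfl⟩

theorem pathSpan_le_succ (n : ℕ) : pathSpan K G n ≤ pathSpan K G (n + 1) :=
  fun _ hx => Submodule.subset_span (Or.inl hx)

theorem pathSpan_mono : Monotone (pathSpan K G) :=
  monotone_nat_of_le_succ pathSpan_le_succ

theorem mul_ge_mem_pathSpan {n : ℕ} {x : LPA K G} (hx : x ∈ pathSpan K G n) (e : Ed) :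
    x * ge K G e ∈ pathSpan K G (n + 1) :=
  Submodule.subset_span (Or.inr ⟨e, x, hx, rfl⟩)

theorem pathSpan_zero_induction {p : LPA K G → Prop} (zero : p 0)
    (elt : ∀ u l, p (trailElt u l))
    (add : ∀ x y, p x → p y → p (x + y)) (smul : ∀ (c : K) x, p x → p (c • x))
    {x : LPA K G} (hx : x ∈ pathSpan K G 0) : p x := by
  refine Submodule.span_induction ?_ zero (fun x y _ _ => add x y) (fun c x _ => smul c x) hx
  rintro _ ⟨⟨u, l⟩, rfl⟩
  exact elt u l

theorem pathSpan_succ_induction {n : ℕ} {p : LPA K G → Prop} (zero : p 0)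
    (base : ∀ x ∈ pathSpan K G n, p x) (ge : ∀ x ∈ pathSpan K G n, ∀ e, p (x * ge K G e))
    (add : ∀ x y, p x → p y → p (x + y)) (smul : ∀ (c : K) x, p x → p (c • x))
    {x : LPA K G} (hx : x ∈ pathSpan K G (n + 1)) : p x := by
  refine Submodule.span_induction ?_ zero (fun x y _ _ => add x y) (fun c x _ => smul c x) hx
  rintro x (hx | ⟨e, y, hy, rfl⟩)
  · exact base x hx
  · exact ge y hy e

theorem mul_mem_pathSpan_of_generators {n m : ℕ} {a : LPA K G}
    (base : ∀ x ∈ pathSpan K G n, x * a ∈ pathSpan K G m)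
    (hge : ∀ x ∈ pathSpan K G n, ∀ e, x * ge K G e * a ∈ pathSpan K G m)
    {x : LPA K G} (hx : x ∈ pathSpan K G (n + 1)) : x * a ∈ pathSpan K G m := by
  refine pathSpan_succ_induction (p := fun x => x * a ∈ pathSpan K G m) ?_ base hge ?_ ?_ hx
  · simp
  · intro x y hx hy
    rw [add_mul]
    exact add_mem hx hy
  · intro c x hx
    rw [smul_mul_assoc]
    exact Submodule.smul_mem _ _ hx

theorem trailElt_concat (u : V) (l : List Ed) (e : Ed) :
    trailElt u (l ++ [e]) = trailElt u l * re K G e := by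
  simp [trailElt, pathProd_append, pathProd_cons, mul_assoc]

theorem mul_vtx_mem_pathSpan {n : ℕ} {x : LPA K G} (hx : x ∈ pathSpan K G n) (v : V) :
    x * vtx K G v ∈ pathSpan K G n := by
  induction n generalizing x with
  | zero =>
    refine pathSpan_zero_induction (p := fun x => x * vtx K G v ∈ pathSpan K G 0) (by simp) ?_ ?_ ?_ hx
    · intro u l
      by_cases h : Trail G u l v
      · rw [trailElt_mul_vtx h]
        exact trailElt_mem_pathSpan u l
      · rw [trailElt_mul_vtx_of_not_trail h]
        exact zero_mem _
    · intro x y hx hy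
      rw [add_mul]
      exact add_mem hx hy
    · intro c x hx
      rw [smul_mul_assoc]
      exact Submodule.smul_mem _ _ hx
  | succ n ih =>
    refine mul_mem_pathSpan_of_generators (fun x hx => pathSpan_le_succ n (ih hx)) ?_ hx
    intro x hx e
    rw [mul_assoc]
    by_cases h : G.src e = v
    · rw [← h, ge_mul_vtx_src]
      exact mul_ge_mem_pathSpan hx e
    · rw [ge_mul_vtx_of_ne h, mul_zero]
      exact zero_mem _

theorem mul_re_mem_pathSpan_zero {x : LPA K G} (hx : x ∈ pathSpan K G 0) (e : Ed) :
    x * re K G e ∈ pathSpan K G 0 := by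
  refine pathSpan_zero_induction (p := fun x => x * re K G e ∈ pathSpan K G 0) (by simp) ?_ ?_ ?_ hx
  · intro u l
    rw [← trailElt_concat]
    exact trailElt_mem_pathSpan _ _
  · intro x y hx hy
    rw [add_mul]
    exact add_mem hx hy
  · intro c x hx
    rw [smul_mul_assoc]
    exact Submodule.smul_mem _ _ hx

theorem mul_re_mem_pathSpan_pred {n : ℕ} {x : LPA K G} (hx : x ∈ pathSpan K G n) (e : Ed) :
    x * re K G e ∈ pathSpan K G (n - 1) := by
  induction n generalizing x with
  | zero => exact mul_re_mem_pathSpan_zero hx e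
  | succ n ih =>
    refine mul_mem_pathSpan_of_generators
      (fun x hx => pathSpan_mono (by omega) (ih hx)) ?_ hx
    intro x hx f
    rw [mul_assoc]
    by_cases h : f = e
    · rw [h, ge_mul_re_self]
      exact mul_vtx_mem_pathSpan hx _
    · rw [ge_mul_re_of_ne h, mul_zero]
      exact zero_mem _

theorem mul_vtx_mem_pathSpan_of_sink {n : ℕ} {v : V} (hv : ∀ e, G.src e ≠ v) {x : LPA K G}
    (hx : x ∈ pathSpan K G (n + 1)) : x * vtx K G v ∈ pathSpan K G n := by
  refine mul_mem_pathSpan_of_generators (fun x hx => mul_vtx_mem_pathSpan hx v) ?_ hx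
  intro x _ e
  rw [mul_assoc, ge_mul_vtx_of_ne (hv e), mul_zero]
  exact zero_mem _

/-- Every element of the algebra is a scalar plus a combination of the elements `μ ν*`. -/
theorem exists_sub_algebraMap_mem_pathSpan (a : LPA K G) :
    ∃ (c : K) (n : ℕ), a - algebraMap K (LPA K G) c ∈ pathSpan K G n := by
  suffices h : (∃ (c : K) (n : ℕ), a - algebraMap K (LPA K G) c ∈ pathSpan K G n) ∧
      ∀ (n : ℕ), ∀ x ∈ pathSpan K G n, ∃ m, x * a ∈ pathSpan K G m from h.1
  obtain ⟨b, rfl⟩ := RingQuot.mkAlgHom_surjective K (LeavittRel K G) a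
  induction b using FreeAlgebra.induction with
  | grade0 c =>
    rw [AlgHom.commutes]
    refine ⟨⟨c, 0, by simp⟩, fun n x hx => ⟨n, ?_⟩⟩
    rw [← Algebra.commutes, ← Algebra.smul_def]
    exact Submodule.smul_mem _ _ hx
  | grade1 g =>
    rcases g with v | e | e
    · refine ⟨⟨0, 0, ?_⟩, fun n x hx => ⟨n, mul_vtx_mem_pathSpan hx v⟩⟩
      rw [map_zero, sub_zero]
      change vtx K G v ∈ _
      rw [← trailElt_nil]
      exact trailElt_mem_pathSpan v []
    · refine ⟨⟨0, 0, ?_⟩, fun n x hx => ⟨n - 1, mul_re_mem_pathSpan_pred hx e⟩⟩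
      rw [map_zero, sub_zero]
      change re K G e ∈ _
      rw [← vtx_src_mul_re, ← trailElt_nil]
      exact mul_re_mem_pathSpan_zero (trailElt_mem_pathSpan _ _) e
    · refine ⟨⟨0, 1, ?_⟩, fun n x hx => ⟨n + 1, mul_ge_mem_pathSpan hx e⟩⟩
      rw [map_zero, sub_zero]
      change ge K G e ∈ _
      rw [← vtx_rng_mul_ge, ← trailElt_nil]
      exact mul_ge_mem_pathSpan (trailElt_mem_pathSpan _ _) e
  | mul a b iha ihb =>
    obtain ⟨⟨c, n, hc⟩, ha⟩ := iha
    obtain ⟨⟨d, m, hd⟩, hb⟩ := ihb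
    rw [map_mul]
    refine ⟨?_, ?_⟩
    · obtain ⟨k, hk⟩ := hb n _ hc
      refine ⟨c * d, max k m, ?_⟩
      have : RingQuot.mkAlgHom K (LeavittRel K G) a * RingQuot.mkAlgHom K (LeavittRel K G) b -
          algebraMap K (LPA K G) (c * d) =
          (RingQuot.mkAlgHom K (LeavittRel K G) a - algebraMap K (LPA K G) c) *
            RingQuot.mkAlgHom K (LeavittRel K G) b +
          c • (RingQuot.mkAlgHom K (LeavittRel K G) b - algebraMap K (LPA K G) d) := by
        have hsmul : c • (RingQuot.mkAlgHom K (LeavittRel K G) b - algebraMap K (LPA K G) d) =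
            algebraMap K (LPA K G) c *
              (RingQuot.mkAlgHom K (LeavittRel K G) b - algebraMap K (LPA K G) d) :=
          Algebra.smul_def _ _
        rw [hsmul, map_mul, sub_mul, mul_sub]
        abel
      rw [this]
      exact add_mem (pathSpan_mono (le_max_left k m) hk)
        (Submodule.smul_mem _ _ (pathSpan_mono (le_max_right k m) hd))
    · intro n x hx
      obtain ⟨k, hk⟩ := ha n x hx
      obtain ⟨l, hl⟩ := hb k _ hk
      exact ⟨l, by rwa [← mul_assoc]⟩
  | add a b iha ihb =>
    obtain ⟨⟨c, n, hc⟩, ha⟩ := iha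
    obtain ⟨⟨d, m, hd⟩, hb⟩ := ihb
    rw [map_add]
    refine ⟨⟨c + d, max n m, ?_⟩, ?_⟩
    · rw [map_add, add_sub_add_comm]
      exact add_mem (pathSpan_mono (le_max_left n m) hc) (pathSpan_mono (le_max_right n m) hd)
    · intro n x hx
      obtain ⟨k, hk⟩ := ha n x hx
      obtain ⟨l, hl⟩ := hb n x hx
      refine ⟨max k l, ?_⟩
      rw [mul_add]
      exact add_mem (pathSpan_mono (le_max_left k l) hk) (pathSpan_mono (le_max_right k l) hl)

theorem vtx_mul_sum {W : Finset V} {v : V} (hv : v ∈ W) :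
    vtx K G v * ∑ w ∈ W, vtx K G w = vtx K G v := by
  rw [Finset.mul_sum, Finset.sum_eq_single_of_mem v hv fun w _ h => vtx_mul_vtx_of_ne h.symm,
    vtx_mul_vtx_self]

theorem sum_mul_vtx {W : Finset V} {v : V} (hv : v ∈ W) :
    (∑ w ∈ W, vtx K G w) * vtx K G v = vtx K G v := by
  rw [Finset.sum_mul, Finset.sum_eq_single_of_mem v hv fun w _ h => vtx_mul_vtx_of_ne h,
    vtx_mul_vtx_self]

theorem exists_sum_mul_eq {x : LPA K G} (hx : x ∈ pathSpan K G 0) :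
    ∃ W : Finset V, ∀ W', W ⊆ W' → (∑ w ∈ W', vtx K G w) * x = x := by
  classical
  refine pathSpan_zero_induction
    (p := fun x => ∃ W : Finset V, ∀ W', W ⊆ W' → (∑ w ∈ W', vtx K G w) * x = x) ⟨∅, by simp⟩ ?_ ?_ ?_ hx
  · intro u l
    refine ⟨{u}, fun W' h => ?_⟩
    rw [trailElt, ← mul_assoc, sum_mul_vtx (h (by simp))]
  · rintro x y ⟨W, h⟩ ⟨W', h'⟩
    refine ⟨W ∪ W', fun U hU => ?_⟩
    rw [mul_add, h U (Finset.union_subset_left hU), h' U (Finset.union_subset_right hU)]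
  · rintro c x ⟨W, h⟩
    exact ⟨W, fun U hU => by rw [mul_smul_comm, h U hU]⟩

theorem exists_trailElt_mul_vtx_eq (u : V) (l : List Ed) :
    ∃ w, trailElt (K := K) (G := G) u l * vtx K G w = trailElt u l := by
  rcases l.eq_nil_or_concat with rfl | ⟨l, e, rfl⟩
  · exact ⟨u, by rw [trailElt_nil, vtx_mul_vtx_self]⟩
  · exact ⟨G.rng e, by rw [List.concat_eq_append, trailElt_concat, mul_assoc, re_mul_vtx_rng]⟩

theorem exists_mul_sum_eq {n : ℕ} {x : LPA K G} (hx : x ∈ pathSpan K G n) :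
    ∃ W : Finset V, ∀ W', W ⊆ W' → x * (∑ w ∈ W', vtx K G w) = x := by
  classical
  have hadd : ∀ x y : LPA K G, (∃ W : Finset V, ∀ W', W ⊆ W' → x * (∑ w ∈ W', vtx K G w) = x) →
      (∃ W : Finset V, ∀ W', W ⊆ W' → y * (∑ w ∈ W', vtx K G w) = y) →
      ∃ W : Finset V, ∀ W', W ⊆ W' → (x + y) * (∑ w ∈ W', vtx K G w) = x + y := by
    rintro x y ⟨W, h⟩ ⟨W', h'⟩
    refine ⟨W ∪ W', fun U hU => ?_⟩
    rw [add_mul, h U (Finset.union_subset_left hU), h' U (Finset.union_subset_right hU)]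
  have hsmul : ∀ (c : K) (x : LPA K G),
      (∃ W : Finset V, ∀ W', W ⊆ W' → x * (∑ w ∈ W', vtx K G w) = x) →
      ∃ W : Finset V, ∀ W', W ⊆ W' → (c • x) * (∑ w ∈ W', vtx K G w) = c • x := by
    rintro c x ⟨W, h⟩
    exact ⟨W, fun U hU => by rw [smul_mul_assoc, h U hU]⟩
  induction n generalizing x with
  | zero =>
    refine pathSpan_zero_induction ⟨∅, by simp⟩ ?_ hadd hsmul hx
    intro u l
    obtain ⟨w, hw⟩ := exists_trailElt_mul_vtx_eq (K := K) (G := G) u l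
    refine ⟨{w}, fun W' h => ?_⟩
    rw [← hw, mul_assoc, vtx_mul_sum (h (by simp))]
  | succ n ih =>
    refine pathSpan_succ_induction ⟨∅, by simp⟩ (fun x hx => ih hx) ?_ hadd hsmul hx
    intro x _ e
    refine ⟨{G.src e}, fun W' h => ?_⟩
    rw [← ge_mul_vtx_src, mul_assoc, mul_assoc, vtx_mul_sum (h (by simp))]

theorem exists_vtx_mul_mul_vtx_eq {x : LPA K G} (hx : x ∈ pathSpan K G 0) (u w : V) :
    ∃ L : List (K × List Ed), (∀ p ∈ L, Trail G u p.2 w) ∧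
      vtx K G u * x * vtx K G w = trailComb u L := by
  refine pathSpan_zero_induction (p := fun x => ∃ L : List (K × List Ed),
    (∀ p ∈ L, Trail G u p.2 w) ∧ vtx K G u * x * vtx K G w = trailComb u L) ⟨[], by simp, by simp [trailComb]⟩ ?_ ?_ ?_ hx
  · intro v l
    by_cases h : u = v ∧ Trail G u l w
    · obtain ⟨rfl, h⟩ := h
      refine ⟨[(1, l)], by simpa using h, ?_⟩
      rw [vtx_mul_trailElt, trailElt_mul_vtx h]
      simp [trailComb]
    · refine ⟨[], by simp, ?_⟩
      by_cases huv : u = v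
      · subst huv
        rw [vtx_mul_trailElt, trailElt_mul_vtx_of_not_trail fun h' => h ⟨rfl, h'⟩]
        simp [trailComb]
      · rw [trailElt, ← mul_assoc, vtx_mul_vtx_of_ne huv]
        simp [trailComb]
  · rintro x y ⟨L, hL, h⟩ ⟨L', hL', h'⟩
    refine ⟨L ++ L', fun p hp => (List.mem_append.1 hp).elim (hL p) (hL' p), ?_⟩
    rw [mul_add, add_mul, h, h']
    simp [trailComb]
  · rintro c x ⟨L, hL, h⟩
    refine ⟨L.map fun p => (c * p.1, p.2), ?_, ?_⟩
    · intro p hp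
      obtain ⟨q, hq, rfl⟩ := List.mem_map.1 hp
      exact hL q hq
    · rw [mul_smul_comm, smul_mul_assoc, h]
      simp only [trailComb, List.map_map, List.smul_sum, Function.comp_def, mul_smul]

theorem SameCycles.mem_of_mem_pathSpan {I J : TwoSidedIdeal (LPA K G)} {F : Set V}
    (hrow : ∀ v : V, {e : Ed | G.src e = v}.Finite) (h : SameCycles I J F) {n : ℕ} {x : LPA K G}
    (hx : x ∈ pathSpan K G n) (hI : x ∈ I) : x ∈ J := by
  induction n generalizing x with
  | zero =>
    obtain ⟨W, hW⟩ := exists_mul_sum_eq hx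
    obtain ⟨U, hU⟩ := exists_sum_mul_eq hx
    rw [← hW W subset_rfl, ← hU U subset_rfl, Finset.sum_mul, Finset.sum_mul]
    refine sum_mem fun u _ => ?_
    rw [Finset.mul_sum]
    refine sum_mem fun w _ => ?_
    obtain ⟨L, hL, heq⟩ := exists_vtx_mul_mul_vtx_eq hx u w
    have hI' : vtx K G u * x * vtx K G w ∈ I := I.mul_mem_right _ _ (I.mul_mem_left _ _ hI)
    rw [heq] at hI' ⊢
    exact h.trailComb_mem hrow (L.map fun p => p.2.length).sum
      (fun p hp => ⟨hL p hp, List.le_sum_of_mem (List.mem_map_of_mem hp)⟩) hI'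
  | succ n ih =>
    obtain ⟨W, hW⟩ := exists_mul_sum_eq hx
    rw [← hW W subset_rfl, Finset.mul_sum]
    refine sum_mem fun w _ => ?_
    by_cases hw : {e : Ed | G.src e = w}.Nonempty
    · rw [vtx_eq_sum (hrow w) hw, Finset.mul_sum]
      refine sum_mem fun e _ => ?_
      rw [← mul_assoc]
      exact J.mul_mem_right _ _
        (ih (mul_re_mem_pathSpan_pred hx e) (I.mul_mem_right _ _ hI))
    · refine ih (mul_vtx_mem_pathSpan_of_sink (fun e he => hw ⟨e, he⟩) hx)
        (I.mul_mem_right _ _ hI)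


theorem Rigid.exists_trailElt_eq_mul_pow {H : Set V} {v : V} (hv : Rigid G H v) :
    ∃ c : LPA K G, ∀ l, Trail G v l v → ∃ k : ℕ, trailElt v l = vtx K G v * c ^ k := by
  classical
  have hex : ∃ n, ∃ l : List Ed, l.length = n ∧ l ≠ [] ∧ Trail G v l v := by
    obtain ⟨l, hl⟩ := hv.exists_closed
    exact ⟨l.length, l, rfl, hl⟩
  obtain ⟨α, hlen, hα, hαv⟩ := Nat.find_spec hex
  refine ⟨trailElt v α, fun l hl => ?_⟩
  induction hn : l.length using Nat.strong_induction_on generalizing l with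
  | _ n ih =>
  subst hn
  by_cases hnil : l = []
  · exact ⟨0, by simp [hnil, trailElt_nil]⟩
  have hle : α.length ≤ l.length := hlen ▸ Nat.find_min' hex ⟨l, rfl, hnil, hl⟩
  have hpre : α <+: l := by
    rcases hv.comparable hαv hv.notMem hl hv.notMem with h | h
    · exact h
    · rw [h.eq_of_length (h.length_le.antisymm hle)]
  obtain ⟨l', rfl⟩ := hpre
  have hpos := List.length_pos_iff.2 hα
  obtain ⟨k, hk⟩ := ih l'.length (by simp; omega) l' (hl.of_append hαv) rfl
  refine ⟨k + 1, ?_⟩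
  rw [trailElt_append hαv, hk, ← mul_assoc, trailElt_mul_vtx hαv, pow_succ', ← mul_assoc,
    vtx_mul_trailElt]

open Polynomial in
theorem exists_aeval_eq_trailComb {v : V} {c : LPA K G}
    (hc : ∀ l, Trail G v l v → ∃ k : ℕ, trailElt v l = vtx K G v * c ^ k)
    (L : List (K × List Ed)) (hL : ∀ p ∈ L, Trail G v p.2 v) :
    ∃ P : K[X], trailComb v L = vtx K G v * aeval c P := by
  induction L with
  | nil => exact ⟨0, by simp [trailComb]⟩
  | cons p L ih =>
    obtain ⟨P, hP⟩ := ih fun q hq => hL q (by simp [hq])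
    obtain ⟨k, hk⟩ := hc p.2 (hL p (by simp))
    refine ⟨p.1 • X ^ k + P, ?_⟩
    rw [trailComb_cons, hk, hP, map_add, mul_add, map_smul, map_pow, aeval_X, mul_smul_comm]

open Polynomial in
/-- The polynomials `P` with `v * P(c)` in a given two-sided ideal. -/
noncomputable def polyIdeal (v : V) (c : LPA K G) (I : TwoSidedIdeal (LPA K G)) : Ideal K[X] where
  carrier := {P | vtx K G v * aeval c P ∈ I}
  zero_mem' := by simp [I.zero_mem]
  add_mem' {P Q} hP hQ := by
    simp only [Set.mem_ofPred_eq, map_add, mul_add]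
    exact I.add_mem hP hQ
  smul_mem' Q P hP := by
    simp only [Set.mem_ofPred_eq, smul_eq_mul, mul_comm Q P, map_mul]
    rw [← mul_assoc]
    exact I.mul_mem_right _ _ hP

theorem exists_polyIdeal_stable (v : V) (a : LPA K G) {c : ℕ → TwoSidedIdeal (LPA K G)}
    (hc : Monotone c) : ∃ n, ∀ m, n ≤ m → polyIdeal v a (c m) = polyIdeal v a (c n) := by
  obtain ⟨n, hn⟩ := monotone_stabilizes_iff_noetherian.2
    (inferInstance : IsNoetherianRing (Polynomial K))
    ⟨fun n => polyIdeal v a (c n), fun i j hij _ hP => hc hij hP⟩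
  exact ⟨n, fun m hm => (hn m hm).symm⟩

/-- The ascending chain condition yields finitely many rigid vertices that every rigid vertex
reaches. -/
theorem exists_finset_rigid
    (hacc : ∀ S : ℕ → Set V, Monotone (fun n => HSClosure G (S n)) →
      ∃ n : ℕ, ∀ m : ℕ, n ≤ m → HSClosure G (S m) = HSClosure G (S n)) {H : Set V}
    (hH : Hereditary G H) :
    ∃ s : Finset V, (∀ v ∈ s, Rigid G H v) ∧
      ∀ u, Rigid G H u → ∃ v ∈ s, ∃ l, Trail G u l v := by
  by_contra! hcon
  obtain ⟨f, hf, hff⟩ := exists_seq_of_forall_finset_exists (Rigid G H)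
    (fun x y => ∀ l, ¬ Trail G y l x) hcon
  obtain ⟨N, hN⟩ := hacc (fun n => H ∪ f '' Set.Iio n) fun i j hij =>
    hsClosure_mono (Set.union_subset_union_right _
      (Set.image_mono (Set.Iio_subset_Iio hij)))
  let Y : Set V :=
    {w | ∀ x l, Trail G w l x → Rigid G H x → ∃ i < N, ∃ l', Trail G x l' (f i)}
  have hY : Hereditary G Y :=
    hereditary_iff.2 fun e he x l hl hx => he x (e :: l) (.cons e hl) hx
  have hYs : Saturated G Y := by
    intro w _ _ h x l hl hx
    have hcons : ∀ {l}, l ≠ [] → Trail G w l x → ∃ i < N, ∃ l', Trail G x l' (f i) := by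
      intro l hne hl
      obtain _ | ⟨e, l⟩ := l
      · exact absurd rfl hne
      · obtain ⟨he, hl⟩ := Trail.cons_iff.1 hl
        exact h e he x l hl hx
    by_cases hnil : l = []
    · obtain rfl : w = x := Trail.nil_iff.1 (hnil ▸ hl)
      obtain ⟨l', hne, hl'⟩ := hx.exists_closed
      exact hcons hne hl'
    · exact hcons hnil hl
  have hsub : H ∪ f '' Set.Iio N ⊆ Y := by
    rintro w (hw | ⟨i, hi, rfl⟩) x l hl hx
    · exact absurd (hl.mem_of_hereditary hH hw) hx.notMem
    · refine ⟨i, hi, ?_⟩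
      obtain ⟨α, hα, hαv⟩ := (hf i).exists_closed
      have hpow := trail_flatten_replicate hαv l.length
      have hlen : l.length ≤ ((List.replicate l.length α).flatten).length := by
        have : 1 ≤ α.length := List.length_pos_iff.2 hα
        simp only [List.length_flatten, List.map_replicate, List.sum_replicate, smul_eq_mul]
        nlinarith
      have hpre : l <+: (List.replicate l.length α).flatten := by
        rcases (hf i).comparable hl hx.notMem hpow (hf i).notMem with h | h
        · exact h
        · rw [h.eq_of_length (h.length_le.antisymm hlen)]
      obtain ⟨l', hl'⟩ := hpre
      exact ⟨l', (hl' ▸ hpow : Trail G (f i) (l ++ l') (f i)).of_append hl⟩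
  have hmem : f N ∈ HSClosure G (H ∪ f '' Set.Iio N) := by
    rw [← hN (N + 1) (Nat.le_succ N)]
    exact subset_hsClosure _ (Or.inr ⟨N, by simp, rfl⟩)
  obtain ⟨i, hi, l, hl⟩ := hsClosure_subset hsub hY hYs hmem (f N) [] (.nil _) (hf N)
  exact hff i N hi l hl

theorem acc_ideals_of_acc_closures (hrow : ∀ v : V, {e : Ed | G.src e = v}.Finite)
    (hacc : ∀ S : ℕ → Set V, Monotone (fun n => HSClosure G (S n)) →
      ∃ n : ℕ, ∀ m : ℕ, n ≤ m → HSClosure G (S m) = HSClosure G (S n))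
    (c : ℕ → TwoSidedIdeal (LPA K G)) (hc : Monotone c) :
    ∃ n : ℕ, ∀ m : ℕ, n ≤ m → c m = c n := by
  have hself : ∀ n, HSClosure G (idealVertices (c n)) = idealVertices (c n) := fun n =>
    hsClosure_eq_self (hereditary_idealVertices _) (saturated_idealVertices _)
  obtain ⟨N₁, hN₁⟩ := hacc (fun n => idealVertices (c n)) fun i j hij =>
    hsClosure_mono fun v hv => hc hij hv
  simp only [hself] at hN₁
  obtain ⟨s, hs, hsr⟩ := exists_finset_rigid hacc (hereditary_idealVertices (c N₁))
  have hpoly : ∀ v, ∃ n, Rigid G (idealVertices (c N₁)) v → ∀ m, n ≤ m →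
      ∀ L : List (K × List Ed), (∀ p ∈ L, Trail G v p.2 v) →
        trailComb v L ∈ c m → trailComb v L ∈ c n := by
    intro v
    by_cases hv : Rigid G (idealVertices (c N₁)) v
    · obtain ⟨a, ha⟩ := hv.exists_trailElt_eq_mul_pow (K := K)
      obtain ⟨n, hn⟩ := exists_polyIdeal_stable v a hc
      refine ⟨n, fun _ m hm L hL hmem => ?_⟩
      obtain ⟨P, hP⟩ := exists_aeval_eq_trailComb ha L hL
      rw [hP] at hmem ⊢
      change P ∈ polyIdeal v a (c m) at hmem
      rwa [hn m hm] at hmem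
    · exact ⟨0, fun h => absurd h hv⟩
  choose N₂ hN₂ using hpoly
  obtain ⟨N₃, hN₃⟩ : ∃ n, ∀ m, (∃ a ∈ c m, ∃ k, a - 1 ∈ pathSpan K G k) →
      ∃ a ∈ c n, ∃ k, a - 1 ∈ pathSpan K G k := by
    by_cases h : ∃ m, ∃ a ∈ c m, ∃ k, a - 1 ∈ pathSpan K G k
    · obtain ⟨n, hn⟩ := h
      exact ⟨n, fun _ _ => hn⟩
    · exact ⟨0, fun m hm => absurd ⟨m, hm⟩ h⟩
  let N := max N₁ (max (s.sup N₂) N₃)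
  have h1 : N₁ ≤ N := le_max_left _ _
  have h2 : ∀ v ∈ s, N₂ v ≤ N := fun v hv =>
    (Finset.le_sup hv).trans ((le_max_left _ _).trans (le_max_right _ _))
  have h3 : N₃ ≤ N := (le_max_right _ _).trans (le_max_right _ _)
  refine ⟨N, fun m hm => le_antisymm ?_ (hc hm)⟩
  have hV : idealVertices (c m) = idealVertices (c N₁) := hN₁ m (h1.trans hm)
  have hsame : SameCycles (c m) (c N) (s : Set V) :=
    { vertices := hV.trans (hN₁ N h1).symm
      rigid_reaches := fun u hu => hsr u (hV ▸ hu)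
      notMem := fun v hv => hV ▸ (hs v hv).notMem
      closed_mem := fun v hv L hL hmem =>
        hc (h2 v hv) (hN₂ v (hs v hv) m ((h2 v hv).trans hm) L hL hmem) }
  intro x hx
  obtain ⟨d, k, hd⟩ := exists_sub_algebraMap_mem_pathSpan x
  by_cases hd0 : d = 0
  · rw [hd0, map_zero, sub_zero] at hd
    exact hsame.mem_of_mem_pathSpan hrow hd hx
  have halg : algebraMap K (LPA K G) d = d • 1 := Algebra.algebraMap_eq_smul_one d
  rw [halg] at hd
  obtain ⟨a, ha, k', hk'⟩ := hN₃ m ⟨d⁻¹ • x, smul_mem_ideal _ _ hx, k, by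
    have := Submodule.smul_mem _ d⁻¹ hd
    rwa [smul_sub, smul_smul, inv_mul_cancel₀ hd0, one_smul] at this⟩
  have haN : d • a ∈ c N := smul_mem_ideal _ _ (hc h3 ha)
  have hdiff : x - d • a ∈ pathSpan K G (max k k') := by
    have heq : x - d • a = (x - d • 1) - d • (a - 1) := by
      rw [smul_sub]
      abel
    rw [heq]
    exact sub_mem (pathSpan_mono (le_max_left k k') hd)
      (Submodule.smul_mem _ _ (pathSpan_mono (le_max_right k k') hk'))
  have := hsame.mem_of_mem_pathSpan hrow hdiff ((c m).sub_mem hx (hc hm haN))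
  simpa using (c N).add_mem this haN


/-- Partial injections `ℕ → ℕ` indexed by the edges with range outside `H`, whose images
partition `ℕ` at every vertex emitting such an edge. -/
theorem exists_edge_encoding (hrow : ∀ v : V, {e : Ed | G.src e = v}.Finite) (H : Set V) :
    ∃ enc : Ed → ℕ → ℕ,
      (∀ e f m n, G.rng e ∉ H → G.rng f ∉ H → G.src e = G.src f → enc e m = enc f n →
        e = f ∧ m = n) ∧
      ∀ e, G.rng e ∉ H → ∀ n, ∃ f, G.src f = G.src e ∧ G.rng f ∉ H ∧ ∃ m, enc f m = n := by
  classical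
  let L : V → Type := fun v => {e : Ed // G.src e = v ∧ G.rng e ∉ H}
  have hfin : ∀ v, Finite (L v) := fun v =>
    Set.Finite.to_subtype ((hrow v).subset fun e (he : G.src e = v ∧ _) => he.1)
  have hex : ∀ v, ∃ φ : L v × ℕ → ℕ, Function.Injective φ ∧
      (Nonempty (L v) → Function.Surjective φ) := by
    intro v
    by_cases h : Nonempty (L v)
    · obtain ⟨φ⟩ : Nonempty (L v × ℕ ≃ ℕ) := nonempty_equiv_of_countable
      exact ⟨φ, φ.injective, fun _ => φ.surjective⟩
    · exact ⟨fun _ => 0, fun x => absurd ⟨x.1⟩ h, fun h' => absurd h' h⟩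
  choose φ hinj hsurj using hex
  refine ⟨fun e n => if h : G.rng e ∉ H then φ (G.src e) (⟨e, rfl, h⟩, n) else 0, ?_, ?_⟩
  · intro e f m n he hf hef h
    simp only [dif_pos he, dif_pos hf] at h
    have key : ∀ v (hv : G.src f = v), φ v (⟨f, hv, hf⟩, n) = φ (G.src f) (⟨f, rfl, hf⟩, n) := by
      rintro _ rfl
      rfl
    rw [← key _ hef.symm] at h
    have := hinj _ h
    obtain ⟨hef', hmn⟩ := Prod.mk.inj this
    exact ⟨congrArg Subtype.val hef', hmn⟩
  · intro e he n
    obtain ⟨⟨⟨f, hf, hf'⟩, m⟩, hm⟩ := hsurj (G.src e) ⟨⟨e, rfl, he⟩⟩ n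
    refine ⟨f, hf, hf', m, ?_⟩
    beta_reduce
    rw [dif_pos hf', ← hm]
    have key : ∀ v (hv : G.src f = v), φ (G.src f) (⟨f, rfl, hf'⟩, m) = φ v (⟨f, hv, hf'⟩, m) := by
      rintro _ rfl
      rfl
    exact key _ hf

section Representation

open scoped Classical

variable (K) (H : Set V) (enc : Ed → ℕ → ℕ)

/-- The action of a vertex on the branching module. -/
noncomputable def vtxOp (v : V) : Module.End K (V → ℕ → K) where
  toFun f w n := if w = v ∧ v ∉ H then f w n else 0
  map_add' f g := by
    ext w n
    by_cases h : w = v ∧ v ∉ H <;> simp [h]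
  map_smul' c f := by
    ext w n
    by_cases h : w = v ∧ v ∉ H <;> simp [h]

variable (G)

/-- The action of an edge on the branching module. -/
noncomputable def reOp (e : Ed) : Module.End K (V → ℕ → K) where
  toFun f w n := if w = G.src e ∧ G.rng e ∉ H then
    (Function.partialInv (enc e) n).elim 0 (f (G.rng e)) else 0
  map_add' f g := by
    ext w n
    by_cases h : w = G.src e ∧ G.rng e ∉ H
    · cases h' : Function.partialInv (enc e) n <;> simp [h, h']
    · simp [h]
  map_smul' c f := by
    ext w n
    by_cases h : w = G.src e ∧ G.rng e ∉ H
    · cases h' : Function.partialInv (enc e) n <;> simp [h, h']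
    · simp [h]

/-- The action of a ghost edge on the branching module. -/
noncomputable def geOp (e : Ed) : Module.End K (V → ℕ → K) where
  toFun f w n := if w = G.rng e ∧ G.rng e ∉ H then f (G.src e) (enc e n) else 0
  map_add' f g := by
    ext w n
    by_cases h : w = G.rng e ∧ G.rng e ∉ H <;> simp [h]
  map_smul' c f := by
    ext w n
    by_cases h : w = G.rng e ∧ G.rng e ∉ H <;> simp [h]

variable {K G H enc}

theorem vtxOp_apply (v : V) (f : V → ℕ → K) (w : V) (n : ℕ) :
    vtxOp K H v f w n = if w = v ∧ v ∉ H then f w n else 0 := rfl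

theorem reOp_apply (e : Ed) (f : V → ℕ → K) (w : V) (n : ℕ) :
    reOp K G H enc e f w n = if w = G.src e ∧ G.rng e ∉ H then
      (Function.partialInv (enc e) n).elim 0 (f (G.rng e)) else 0 := rfl

theorem geOp_apply (e : Ed) (f : V → ℕ → K) (w : V) (n : ℕ) :
    geOp K G H enc e f w n =
      if w = G.rng e ∧ G.rng e ∉ H then f (G.src e) (enc e n) else 0 := rfl

/-- Outside a hereditary saturated set, vertices act nontrivially on a module on which the
vertices of that set act as zero. -/
theorem exists_representation (hrow : ∀ v : V, {e : Ed | G.src e = v}.Finite)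
    (hH : Hereditary G H) (hs : Saturated G H) :
    ∃ ρ : LPA K G →ₐ[K] Module.End K (V → ℕ → K), ∀ v, ρ (vtx K G v) = vtxOp K H v := by
  obtain ⟨enc, henc, hsurj⟩ := exists_edge_encoding (G := G) hrow H
  have hsrc : ∀ e, G.rng e ∉ H → G.src e ∉ H := fun e he h => he (hereditary_iff.1 hH e h)
  have hinv : ∀ e, G.rng e ∉ H → ∀ n, Function.partialInv (enc e) (enc e n) = some n :=
    fun e he n => Function.partialInv_left (fun a b h => (henc e e a b he he rfl h).2) n
  have hinv_ne : ∀ e f, G.rng e ∉ H → G.rng f ∉ H → G.src e = G.src f → e ≠ f → ∀ n,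
      Function.partialInv (enc e) (enc f n) = none := by
    intro e f he hf hef hne n
    rw [Option.eq_none_iff_forall_ne_some]
    intro m hm
    have hm' := (Function.Injective.isPartialInv
      (fun a b h => (henc e e a b he he rfl h).2) m (enc f n)).1 hm
    exact hne (henc e f m n he hf hef hm').1
  let ψ : FreeAlgebra K (LGen V Ed) →ₐ[K] Module.End K (V → ℕ → K) :=
    FreeAlgebra.lift K (Sum.elim (vtxOp K H) (Sum.elim (reOp K G H enc) (geOp K G H enc)))
  have hv : ∀ v, ψ (fvtx K v) = vtxOp K H v := fun v => by simp [ψ, fvtx]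
  have hr : ∀ e, ψ (fre K e) = reOp K G H enc e := fun e => by simp [ψ, fre]
  have hg : ∀ e, ψ (fge K e) = geOp K G H enc e := fun e => by simp [ψ, fge]
  have hrel : ∀ ⦃x y⦄, LeavittRel K G x y → ψ x = ψ y := by
    intro x y hxy
    induction hxy with
    | vv v w =>
      by_cases hvw : v = w
      · subst hvw
        rw [if_pos rfl, map_mul, hv]
        ext f u n
        simp only [Module.End.mul_apply, vtxOp_apply]
        split_ifs <;> rfl
      · rw [if_neg hvw, map_mul, hv, hv, map_zero]
        ext f u n
        simp only [Module.End.mul_apply, vtxOp_apply, LinearMap.zero_apply, Pi.zero_apply]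
        grind
    | se e =>
      rw [map_mul, hv, hr]
      ext f u n
      simp only [Module.End.mul_apply, vtxOp_apply, reOp_apply]
      grind
    | er e =>
      rw [map_mul, hv, hr]
      ext f u n
      simp only [Module.End.mul_apply, reOp_apply]
      by_cases h : G.rng e ∈ H
      · simp [h]
      · cases Function.partialInv (enc e) n <;> simp [h, vtxOp_apply]
    | rg e =>
      rw [map_mul, hv, hg]
      ext f u n
      simp only [Module.End.mul_apply, vtxOp_apply, geOp_apply]
      grind
    | gs e =>
      rw [map_mul, hv, hg]
      ext f u n
      simp only [Module.End.mul_apply, vtxOp_apply, geOp_apply]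
      grind
    | gf e f =>
      by_cases hef : e = f
      · subst hef
        rw [if_pos rfl, map_mul, hg, hr, hv]
        ext g u n
        simp only [Module.End.mul_apply, geOp_apply, reOp_apply, vtxOp_apply]
        by_cases h : u = G.rng e ∧ G.rng e ∉ H
        · simp [h, hinv e h.2 n]
        · simp [h]
      · rw [if_neg hef, map_mul, hg, hr, map_zero]
        ext g u n
        simp only [Module.End.mul_apply, geOp_apply, reOp_apply, LinearMap.zero_apply,
          Pi.zero_apply]
        by_cases h : (u = G.rng e ∧ G.rng e ∉ H) ∧ (G.src e = G.src f ∧ G.rng f ∉ H)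
        · rw [if_pos h.1, if_pos h.2, hinv_ne f e h.2.2 h.1.2 h.2.1.symm (Ne.symm hef)]
          rfl
        · grind
    | ck v hfin hne =>
      rw [map_sum, hv]
      ext g w n
      simp only [LinearMap.sum_apply, Finset.sum_apply, map_mul, hr, hg, Module.End.mul_apply,
        vtxOp_apply]
      by_cases h : w = v ∧ v ∉ H
      · obtain ⟨rfl, hw⟩ := h
        have hlive : ∃ e, G.src e = w ∧ G.rng e ∉ H := by
          by_contra! hcon
          exact hw (hs w hfin hne hcon)
        obtain ⟨e, rfl, he⟩ := hlive
        obtain ⟨e', he', hlive', m, rfl⟩ := hsurj e he n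
        rw [Finset.sum_eq_single_of_mem e' (by simpa using he')]
        · simp [reOp_apply, geOp_apply, he', hlive', hinv e' hlive' m, hw]
        · intro b hb hne'
          have hb' : G.src b = G.src e := by simpa using hb
          rw [reOp_apply]
          by_cases hbH : G.rng b ∈ H
          · simp [hbH]
          · rw [hinv_ne b e' hbH hlive' (hb'.trans he'.symm) hne']
            simp
      · rw [if_neg h, Finset.sum_eq_zero]
        intro e he
        have he' : G.src e = v := by simpa using he
        rw [reOp_apply, if_neg]
        rintro ⟨rfl, hlive⟩
        exact h ⟨he', he' ▸ hsrc e hlive⟩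
  refine ⟨RingQuot.liftAlgHom K ⟨ψ, hrel⟩, fun v => ?_⟩
  rw [vtx, RingQuot.liftAlgHom_mkAlgHom_apply, hv]

end Representation

theorem idealVertices_span (hrow : ∀ v : V, {e : Ed | G.src e = v}.Finite) {H : Set V}
    (hH : Hereditary G H) (hs : Saturated G H) :
    idealVertices (TwoSidedIdeal.span (vtx K G '' H)) = H := by
  refine Set.Subset.antisymm ?_ fun v hv => TwoSidedIdeal.subset_span ⟨v, hv, rfl⟩
  intro v hv
  by_contra hvH
  obtain ⟨ρ, hρ⟩ := exists_representation (K := K) hrow hH hs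
  have hle : TwoSidedIdeal.span (vtx K G '' H) ≤ TwoSidedIdeal.ker ρ := by
    rw [TwoSidedIdeal.span_le]
    rintro _ ⟨w, hw, rfl⟩
    rw [SetLike.mem_coe, TwoSidedIdeal.mem_ker, hρ]
    ext f u n
    simp [vtxOp_apply, hw]
  have hker := hle hv
  rw [TwoSidedIdeal.mem_ker, hρ] at hker
  have := congrFun (congrFun (LinearMap.congr_fun hker fun _ _ => (1 : K)) v) 0
  simp [vtxOp_apply, hvH] at this

theorem acc_closures_of_acc_ideals (hrow : ∀ v : V, {e : Ed | G.src e = v}.Finite)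
    (hacc : ∀ c : ℕ → TwoSidedIdeal (LPA K G), Monotone c →
      ∃ n : ℕ, ∀ m : ℕ, n ≤ m → c m = c n)
    (S : ℕ → Set V) (hS : Monotone fun n => HSClosure G (S n)) :
    ∃ n : ℕ, ∀ m : ℕ, n ≤ m → HSClosure G (S m) = HSClosure G (S n) := by
  obtain ⟨n, hn⟩ := hacc (fun n => TwoSidedIdeal.span (vtx K G '' HSClosure G (S n)))
    fun i j hij => TwoSidedIdeal.span_mono (Set.image_mono (hS hij))
  refine ⟨n, fun m hm => ?_⟩
  have h := congrArg idealVertices (hn m hm)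
  rwa [idealVertices_span hrow (hereditary_hsClosure _) (saturated_hsClosure _),
    idealVertices_span hrow (hereditary_hsClosure _) (saturated_hsClosure _)] at h

end LPA

/-- for a row-finite graph, `L_K(E)` satisfies the a.c.c. on two-sided ideals iff
the hereditary saturated closures of subsets of `E⁰` satisfy the a.c.c.. -/
theorem acc_ideals_iff_acc_closures (hrow : ∀ v : V, ({e : Ed | G.src e = v}).Finite) :
    (∀ c : ℕ → TwoSidedIdeal (LPA K G), Monotone c → ∃ n : ℕ, ∀ m : ℕ, n ≤ m → c m = c n) ↔
    (∀ S : ℕ → Set V, Monotone (fun n => HSClosure G (S n)) →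
      ∃ n : ℕ, ∀ m : ℕ, n ≤ m → HSClosure G (S m) = HSClosure G (S n)) := by
  exact ⟨fun h => LPA.acc_closures_of_acc_ideals hrow h,
    fun h => LPA.acc_ideals_of_acc_closures hrow h⟩
end

section
/- Let E be a finite directed graph (both E⁰ and E¹ are finite sets) and K a field. Then the Leavitt path algebra L_K(E) is two-sided Noetherian, i.e., it satisfies the ascending chain condition on two-sided ideals. -/
variable {V Ed : Type}

variable (K : Type) [Field K]

variable (G : DirGraph V Ed)

/-- A Leavitt family over a finite graph whose vertex idempotents sum to one. -/
structure LeavittFamily {W E : Type} [Fintype W] [Fintype E] [DecidableEq W] [DecidableEq E]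
    (D : DirGraph W E) (A : Type) [Ring A] where
  P : W → A
  s : E → A
  t : E → A
  P_mul_P : ∀ v w, P v * P w = if v = w then P v else 0
  P_mul_s : ∀ e, P (D.src e) * s e = s e
  s_mul_P : ∀ e, s e * P (D.rng e) = s e
  P_mul_t : ∀ e, P (D.rng e) * t e = t e
  t_mul_P : ∀ e, t e * P (D.src e) = t e
  t_mul_s : ∀ e f, t e * s f = if e = f then P (D.rng e) else 0
  ck : ∀ v, (∃ e, D.src e = v) → P v = ∑ e with D.src e = v, s e * t e
  sum_P : ∑ v, P v = 1

namespace LeavittFamily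

section

variable {W E : Type} [Fintype W] [Fintype E] [DecidableEq W] [DecidableEq E]
  {D : DirGraph W E} {A : Type} [Ring A] (F : LeavittFamily D A)

lemma P_mul_s_of_ne {v : W} {e : E} (h : D.src e ≠ v) : F.P v * F.s e = 0 := by
  rw [← F.P_mul_s e, ← mul_assoc, F.P_mul_P, if_neg (Ne.symm h), zero_mul]

lemma s_mul_P_of_ne {v : W} {e : E} (h : D.rng e ≠ v) : F.s e * F.P v = 0 := by
  rw [← F.s_mul_P e, mul_assoc, F.P_mul_P, if_neg h, mul_zero]

lemma t_mul_P_of_ne {v : W} {e : E} (h : D.src e ≠ v) : F.t e * F.P v = 0 := by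
  rw [← F.t_mul_P e, mul_assoc, F.P_mul_P, if_neg h, mul_zero]

lemma exists_mul_P_ne_zero {a : A} (ha : a ≠ 0) : ∃ v, a * F.P v ≠ 0 := by
  by_contra! h
  apply ha
  rw [← mul_one a, ← F.sum_P, Finset.mul_sum]
  exact Finset.sum_eq_zero fun v _ => h v

lemma exists_P_mul_ne_zero {a : A} (ha : a ≠ 0) : ∃ v, F.P v * a ≠ 0 := by
  by_contra! h
  apply ha
  rw [← one_mul a, ← F.sum_P, Finset.sum_mul]
  exact Finset.sum_eq_zero fun v _ => h v

lemma exists_mul_s_ne_zero {a : A} {v : W} (hv : ∃ e, D.src e = v) (ha : a * F.P v ≠ 0) :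
    ∃ e, D.src e = v ∧ a * F.s e ≠ 0 := by
  by_contra! h
  apply ha
  rw [F.ck v hv, Finset.mul_sum]
  refine Finset.sum_eq_zero fun e he => ?_
  rw [← mul_assoc, h e (by simpa using he), zero_mul]

lemma exists_t_mul_ne_zero {a : A} {v : W} (hv : ∃ e, D.src e = v) (ha : F.P v * a ≠ 0) :
    ∃ e, D.src e = v ∧ F.t e * a ≠ 0 := by
  by_contra! h
  apply ha
  rw [F.ck v hv, Finset.sum_mul]
  refine Finset.sum_eq_zero fun e he => ?_
  rw [mul_assoc, h e (by simpa using he), mul_zero]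

/-- The image of a Leavitt family under a ring homomorphism. -/
def map {B : Type} [Ring B] (φ : A →+* B) : LeavittFamily D B where
  P v := φ (F.P v)
  s e := φ (F.s e)
  t e := φ (F.t e)
  P_mul_P v w := by rw [← map_mul, F.P_mul_P]; split_ifs <;> simp
  P_mul_s e := by rw [← map_mul, F.P_mul_s]
  s_mul_P e := by rw [← map_mul, F.s_mul_P]
  P_mul_t e := by rw [← map_mul, F.P_mul_t]
  t_mul_P e := by rw [← map_mul, F.t_mul_P]
  t_mul_s e f := by rw [← map_mul, F.t_mul_s]; split_ifs <;> simp
  ck v hv := by rw [F.ck v hv]; simp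
  sum_P := by rw [← map_sum, F.sum_P, map_one]

/-- The product of the real edges in a list. -/
def pathElt (l : List E) : A := (l.map F.s).prod

/-- The edges met by following the choice `σ` of outgoing edges for `n` steps from `v`. -/
def walkList (D : DirGraph W E) (σ : W → E) (v : W) (n : ℕ) : List E :=
  (List.range n).map fun k => σ ((D.rng ∘ σ)^[k] v)

omit [Fintype W] [Fintype E] [DecidableEq W] [DecidableEq E] in
lemma walkList_add (D : DirGraph W E) (σ : W → E) (v : W) (m n : ℕ) :
    walkList D σ v (m + n) = walkList D σ v m ++ walkList D σ ((D.rng ∘ σ)^[m] v) n := by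
  simp only [walkList, List.range_add, List.map_append, List.map_map]
  congr 1
  refine List.map_congr_left fun k _ => ?_
  simp only [Function.comp_apply, ← Function.iterate_add_apply, add_comm m k]

lemma pathElt_append (l m : List E) : F.pathElt (l ++ m) = F.pathElt l * F.pathElt m := by
  simp [pathElt]

lemma pathElt_cons (e : E) (l : List E) : F.pathElt (e :: l) = F.s e * F.pathElt l := by
  simp [pathElt]

lemma pathElt_walkList_mul_period (σ : W → E) (v : W) (q : ℕ) :
    F.pathElt (walkList D σ v (Function.minimalPeriod (D.rng ∘ σ) v * q)) =
      F.pathElt (walkList D σ v (Function.minimalPeriod (D.rng ∘ σ) v)) ^ q := by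
  induction q with
  | zero => simp [walkList, pathElt]
  | succ q ih =>
    rw [Nat.mul_succ, walkList_add, pathElt_append, ih, pow_succ,
      ((Function.isPeriodicPt_minimalPeriod _ v).mul_const q).eq]

lemma pathElt_walkList_mul_P (σ : W → E) (v w : W) (n : ℕ) :
    F.P v * F.pathElt (walkList D σ v n) * F.P w =
      if (D.rng ∘ σ)^[n] v = w then F.P v * F.pathElt (walkList D σ v n) else 0 := by
  cases n with
  | zero => simp [walkList, pathElt, F.P_mul_P]
  | succ n =>
    have h : F.pathElt (walkList D σ v (n + 1)) =
        F.pathElt (walkList D σ v n) * F.s (σ ((D.rng ∘ σ)^[n] v)) := by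
      rw [walkList_add, pathElt_append]; simp [walkList, pathElt]
    rw [Function.iterate_succ_apply', Function.comp_apply]
    split_ifs with hw
    · rw [h, ← hw, mul_assoc, mul_assoc, F.s_mul_P]
    · rw [h, mul_assoc, mul_assoc, F.s_mul_P_of_ne hw, mul_zero, mul_zero]

variable {K} [Algebra K A]

/-- The combination of real paths from `v` to `w` with coefficients `f`. -/
noncomputable def toElt (v w : W) : (List E →₀ K) →ₗ[K] A :=
  Finsupp.linearCombination K fun l => F.P v * F.pathElt l * F.P w

lemma toElt_single (v w : W) (l : List E) (k : K) :
    F.toElt v w (Finsupp.single l k) = k • (F.P v * F.pathElt l * F.P w) := by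
  simp [toElt]

/-- The coefficients of the paths starting with `e`, with that first edge removed. -/
noncomputable def strip (e : E) (f : List E →₀ K) : List E →₀ K :=
  f.comapDomain (e :: ·) (List.cons_injective.injOn)

omit [Fintype E] [DecidableEq E] in
lemma strip_apply (e : E) (f : List E →₀ K) (l : List E) : strip e f l = f (e :: l) := rfl

omit [Fintype E] in
lemma strip_single_cons (e g : E) (l : List E) (k : K) :
    strip e (Finsupp.single (g :: l) k) = if e = g then Finsupp.single l k else 0 := by
  ext m
  rw [strip_apply, Finsupp.single_apply]
  split_ifs with h h' h' <;> simp_all [eq_comm]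

lemma t_mul_toElt {e : E} {v : W} (he : D.src e = v) (w : W) (f : List E →₀ K) :
    F.t e * F.toElt v w f = F.toElt (D.rng e) w (strip e f) + f [] • (F.t e * F.P w) := by
  induction f using Finsupp.induction_linear with
  | zero => simp [strip]
  | add f g hf hg =>
    have : strip e (f + g) = strip e f + strip e g := by ext; simp [strip_apply]
    rw [map_add, mul_add, hf, hg, this, map_add, Finsupp.add_apply, add_smul]
    abel
  | single l k =>
    have ht : ∀ x, F.t e * (F.P v * x) = F.t e * x := fun x => by
      rw [← mul_assoc, ← he, F.t_mul_P]
    cases l with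
    | nil =>
      have : strip e (Finsupp.single ([] : List E) k) = 0 := by ext; simp [strip_apply]
      rw [this, toElt_single, mul_smul_comm, mul_assoc, ht]
      simp [pathElt]
    | cons g l =>
      rw [strip_single_cons, toElt_single, mul_smul_comm, mul_assoc, ht, pathElt_cons,
        mul_assoc, ← mul_assoc (F.t e), F.t_mul_s]
      split_ifs with h
      · subst h
        simp [toElt_single, mul_assoc]
      · simp

lemma toElt_mul_s {g : E} {w : W} (hg : D.src g = w) (v : W) (f : List E →₀ K) :
    F.toElt v w f * F.s g = F.toElt v (D.rng g) (f.mapDomain (· ++ [g])) := by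
  induction f using Finsupp.induction_linear with
  | zero => simp
  | add f g hf hg => rw [map_add, add_mul, hf, hg, Finsupp.mapDomain_add, map_add]
  | single l k =>
    rw [Finsupp.mapDomain_single, toElt_single, toElt_single, smul_mul_assoc, pathElt_append,
      mul_assoc, ← hg, F.P_mul_s]
    simp [pathElt, mul_assoc, F.s_mul_P]

lemma toElt_mul_P (v w u : W) (f : List E →₀ K) :
    F.toElt v w f * F.P u = if w = u then F.toElt v w f else 0 := by
  induction f using Finsupp.induction_linear with
  | zero => simp
  | add f g hf hg => rw [map_add, add_mul, hf, hg]; split_ifs <;> simp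
  | single l k =>
    rw [toElt_single, smul_mul_assoc, mul_assoc, F.P_mul_P]
    split_ifs <;> simp

lemma P_mul_toElt (v w : W) (f : List E →₀ K) : F.P v * F.toElt v w f = F.toElt v w f := by
  induction f using Finsupp.induction_linear with
  | zero => simp
  | add f g hf hg => rw [map_add, mul_add, hf, hg]
  | single l k =>
    rw [toElt_single, mul_smul_comm, ← mul_assoc, ← mul_assoc, F.P_mul_P, if_pos rfl]

variable (K) in
/-- An element all of whose corners are combinations of real paths. -/
def IsReal (a : A) : Prop := ∀ v w, ∃ f : List E →₀ K, F.P v * a * F.P w = F.toElt v w f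

lemma isReal_one : F.IsReal K (1 : A) := fun v w =>
  ⟨Finsupp.single [] 1, by simp [toElt_single, pathElt]⟩

lemma IsReal.add {a b : A} (ha : F.IsReal K a) (hb : F.IsReal K b) : F.IsReal K (a + b) :=
  fun v w => by
    obtain ⟨f, hf⟩ := ha v w
    obtain ⟨g, hg⟩ := hb v w
    exact ⟨f + g, by rw [map_add, ← hf, ← hg, mul_add, add_mul]⟩

lemma IsReal.smul {a : A} (k : K) (ha : F.IsReal K a) : F.IsReal K (k • a) :=
  fun v w => by
    obtain ⟨f, hf⟩ := ha v w
    exact ⟨k • f, by rw [map_smul, ← hf, mul_smul_comm, smul_mul_assoc]⟩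

lemma isReal_zero : F.IsReal K (0 : A) := fun _ _ => ⟨0, by simp⟩

lemma IsReal.mul_P {a : A} (ha : F.IsReal K a) (u : W) : F.IsReal K (a * F.P u) :=
  fun v w => by
    by_cases h : u = w
    · obtain ⟨f, hf⟩ := ha v w
      exact ⟨f, by rw [← hf, ← h, mul_assoc, mul_assoc, F.P_mul_P, if_pos rfl, ← mul_assoc]⟩
    · exact ⟨0, by rw [mul_assoc, mul_assoc, F.P_mul_P, if_neg h]; simp⟩

lemma IsReal.mul_s {a : A} (ha : F.IsReal K a) (e : E) : F.IsReal K (a * F.s e) :=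
  fun v w => by
    by_cases h : D.rng e = w
    · obtain ⟨f, hf⟩ := ha v (D.src e)
      refine ⟨f.mapDomain (· ++ [e]), ?_⟩
      rw [← h, ← F.toElt_mul_s rfl, ← hf]
      simp only [mul_assoc, F.s_mul_P, F.P_mul_s]
    · exact ⟨0, by rw [mul_assoc, mul_assoc, F.s_mul_P_of_ne h]; simp⟩

variable (K) in
/-- Right multiplication by any `n` real edges turns the element into a combination of real
paths. -/
def GhostDegreeLE : ℕ → A → Prop
  | 0, a => F.IsReal K a
  | n + 1, a => (∀ e, GhostDegreeLE n (a * F.s e)) ∧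
      ∀ v, (∀ e, D.src e ≠ v) → F.IsReal K (a * F.P v)

lemma GhostDegreeLE.zero (n : ℕ) : F.GhostDegreeLE K n 0 := by
  induction n with
  | zero => exact F.isReal_zero
  | succ n ih => exact ⟨fun e => by rwa [zero_mul], fun v _ => by rw [zero_mul]; exact F.isReal_zero⟩

lemma GhostDegreeLE.succ {n : ℕ} {a : A} (h : F.GhostDegreeLE K n a) :
    F.GhostDegreeLE K (n + 1) a := by
  induction n generalizing a with
  | zero => exact ⟨fun e => IsReal.mul_s F h e, fun v _ => IsReal.mul_P F h v⟩
  | succ n ih => exact ⟨fun e => ih (h.1 e), h.2⟩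

lemma GhostDegreeLE.mono {m n : ℕ} (hmn : m ≤ n) {a : A} (h : F.GhostDegreeLE K m a) :
    F.GhostDegreeLE K n a := by
  induction hmn with
  | refl => exact h
  | step _ ih => exact ih.succ

lemma GhostDegreeLE.add {n : ℕ} {a b : A} (ha : F.GhostDegreeLE K n a)
    (hb : F.GhostDegreeLE K n b) : F.GhostDegreeLE K n (a + b) := by
  induction n generalizing a b with
  | zero => exact IsReal.add F ha hb
  | succ n ih =>
    refine ⟨fun e => ?_, fun v hv => ?_⟩
    · rw [add_mul]; exact ih (ha.1 e) (hb.1 e)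
    · rw [add_mul]; exact IsReal.add F (ha.2 v hv) (hb.2 v hv)

lemma GhostDegreeLE.smul {n : ℕ} {a : A} (k : K) (ha : F.GhostDegreeLE K n a) :
    F.GhostDegreeLE K n (k • a) := by
  induction n generalizing a with
  | zero => exact IsReal.smul F k ha
  | succ n ih =>
    refine ⟨fun e => ?_, fun v hv => ?_⟩
    · rw [smul_mul_assoc]; exact ih (ha.1 e)
    · rw [smul_mul_assoc]; exact IsReal.smul F k (ha.2 v hv)

lemma GhostDegreeLE.mul_P {n : ℕ} {a : A} (ha : F.GhostDegreeLE K n a) (u : W) :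
    F.GhostDegreeLE K n (a * F.P u) := by
  cases n with
  | zero => exact IsReal.mul_P F ha u
  | succ n =>
    refine ⟨fun e => ?_, fun v hv => ?_⟩
    · by_cases h : D.src e = u
      · rw [mul_assoc, ← h, F.P_mul_s]; exact ha.1 e
      · rw [mul_assoc, F.P_mul_s_of_ne h, mul_zero]; exact GhostDegreeLE.zero F n
    · rw [mul_assoc, F.P_mul_P]
      split_ifs with h
      · subst h; exact ha.2 u hv
      · rw [mul_zero]; exact F.isReal_zero

lemma GhostDegreeLE.mul_s {n : ℕ} {a : A} (ha : F.GhostDegreeLE K n a) (e : E) :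
    F.GhostDegreeLE K n (a * F.s e) := by
  cases n with
  | zero => exact IsReal.mul_s F ha e
  | succ n => exact (ha.1 e).succ

lemma GhostDegreeLE.mul_t {n : ℕ} {a : A} (ha : F.GhostDegreeLE K n a) (e : E) :
    F.GhostDegreeLE K (n + 1) (a * F.t e) := by
  refine ⟨fun g => ?_, fun v hv => ?_⟩
  · rw [mul_assoc, F.t_mul_s]
    split_ifs
    · exact GhostDegreeLE.mul_P F ha _
    · rw [mul_zero]; exact GhostDegreeLE.zero F n
  · rw [mul_assoc, F.t_mul_P_of_ne (hv e), mul_zero]; exact F.isReal_zero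

variable (K) in
/-- The family generates `A` as a `K`-algebra. -/
def Generates : Prop :=
  Algebra.adjoin K (Set.range F.P ∪ Set.range F.s ∪ Set.range F.t) = ⊤

lemma exists_ghostDegreeLE (hF : F.Generates K) (a : A) : ∃ n, F.GhostDegreeLE K n a := by
  suffices h : ∀ x ∈ Algebra.adjoin K (Set.range F.P ∪ Set.range F.s ∪ Set.range F.t),
      ∀ b, (∃ n, F.GhostDegreeLE K n b) → ∃ n, F.GhostDegreeLE K n (b * x) by
    simpa using h a (hF ▸ Algebra.mem_top) 1 ⟨0, F.isReal_one⟩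
  intro x hx
  induction hx using Algebra.adjoin_induction with
  | mem x hx =>
    rintro b ⟨n, hn⟩
    rcases hx with (⟨v, rfl⟩ | ⟨e, rfl⟩) | ⟨e, rfl⟩
    · exact ⟨n, GhostDegreeLE.mul_P F hn v⟩
    · exact ⟨n, GhostDegreeLE.mul_s F hn e⟩
    · exact ⟨n + 1, GhostDegreeLE.mul_t F hn e⟩
  | algebraMap k =>
    rintro b ⟨n, hn⟩
    exact ⟨n, by rw [← Algebra.commutes, ← Algebra.smul_def]; exact GhostDegreeLE.smul F k hn⟩
  | add x y _ _ hx hy =>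
    intro b hb
    obtain ⟨m, hm⟩ := hx b hb
    obtain ⟨n, hn⟩ := hy b hb
    refine ⟨max m n, ?_⟩
    rw [mul_add]
    exact GhostDegreeLE.add F (GhostDegreeLE.mono F (le_max_left _ _) hm)
      (GhostDegreeLE.mono F (le_max_right _ _) hn)
  | mul x y _ _ hx hy =>
    intro b hb
    rw [← mul_assoc]
    exact hy _ (hx b hb)

lemma exists_isReal_mul_ne_zero (hF : F.Generates K) {a : A} (ha : a ≠ 0) :
    ∃ y, F.IsReal K (a * y) ∧ a * y ≠ 0 := by
  obtain ⟨n, hn⟩ := F.exists_ghostDegreeLE hF a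
  induction n generalizing a with
  | zero => exact ⟨1, by rwa [mul_one], by rwa [mul_one]⟩
  | succ n ih =>
    obtain ⟨v, hv⟩ := F.exists_mul_P_ne_zero ha
    by_cases hs : ∃ e, D.src e = v
    · obtain ⟨e, -, he⟩ := F.exists_mul_s_ne_zero hs hv
      obtain ⟨y, hy, hy'⟩ := ih he (hn.1 e)
      exact ⟨F.s e * y, by rwa [← mul_assoc], by rwa [← mul_assoc]⟩
    · push Not at hs
      exact ⟨F.P v, hn.2 v hs, hv⟩

lemma exists_toElt_ne_zero (hF : F.Generates K) {a : A} (ha : a ≠ 0) :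
    ∃ x y v w, ∃ f : List E →₀ K, x * a * y = F.toElt v w f ∧ F.toElt v w f ≠ 0 := by
  obtain ⟨y, hy, hy'⟩ := F.exists_isReal_mul_ne_zero hF ha
  obtain ⟨w, hw⟩ := F.exists_mul_P_ne_zero hy'
  obtain ⟨v, hv⟩ := F.exists_P_mul_ne_zero hw
  obtain ⟨f, hf⟩ := hy v w
  refine ⟨F.P v, y * F.P w, v, w, f, ?_, ?_⟩
  · rw [← hf]; simp only [mul_assoc]
  · rw [← hf]; simpa only [mul_assoc] using hv

/-- The total size of the paths occurring in `f`. -/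
def weight (f : List E →₀ K) : ℕ := ∑ l ∈ f.support, (l.length + 1)

omit [Fintype E] in
lemma sum_le_sum_length {S T : Finset (List E)} {c : List E → ℕ} (φ : List E → List E)
    (hφ : ∀ l ∈ S, φ l ∈ T) (hinj : Set.InjOn φ S) (hc : ∀ l ∈ S, c l ≤ (φ l).length + 1) :
    ∑ l ∈ S, c l ≤ ∑ l ∈ T, (l.length + 1) := by
  calc ∑ l ∈ S, c l ≤ ∑ l ∈ S, ((φ l).length + 1) := Finset.sum_le_sum hc
    _ = ∑ l ∈ S.image φ, (l.length + 1) := (Finset.sum_image (f := fun l => l.length + 1) hinj).symm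
    _ ≤ _ := Finset.sum_le_sum_of_subset (Finset.image_subset_iff.2 hφ)

omit [Fintype E] in
lemma sum_erase_lt_weight {f : List E →₀ K} {l : List E} (hl : l ∈ f.support) :
    ∑ m ∈ f.support.erase l, (m.length + 1) < weight f := by
  rw [weight, ← Finset.add_sum_erase _ _ hl]
  lia

/-- The coefficients of `e* a g` in terms of those of a combination `a` of closed real paths. -/
noncomputable def rotate (e g : E) (f : List E →₀ K) : List E →₀ K :=
  (strip e f).mapDomain (· ++ [g]) + if e = g then Finsupp.single [] (f []) else 0

lemma t_mul_toElt_mul_s {e g : E} {v : W} (he : D.src e = v) (hg : D.src g = v)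
    (f : List E →₀ K) :
    F.t e * F.toElt v v f * F.s g = F.toElt (D.rng e) (D.rng g) (rotate e g f) := by
  rw [F.t_mul_toElt he, add_mul, F.toElt_mul_s hg, rotate, map_add, smul_mul_assoc, mul_assoc,
    ← hg, F.P_mul_s, F.t_mul_s]
  congr 1
  split_ifs with h
  · subst h
    rw [toElt_single]
    simp [pathElt, F.P_mul_P]
  · simp

omit [Fintype E] in
lemma rotate_apply_append (e g : E) (f : List E →₀ K) (l : List E) :
    rotate e g f (l ++ [g]) = f (e :: l) := by
  rw [rotate, Finsupp.add_apply, Finsupp.mapDomain_apply (List.append_left_injective [g]),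
    strip_apply]
  split_ifs <;> simp

omit [Fintype E] in
lemma mem_support_rotate {e g : E} {f : List E →₀ K} {l : List E}
    (hl : l ∈ (rotate e g f).support) :
    (l = [] ∧ e = g ∧ [] ∈ f.support) ∨ ∃ m, l = m ++ [g] ∧ e :: m ∈ f.support := by
  rcases Finset.mem_union.1 (Finsupp.support_add hl) with h | h
  · obtain ⟨m, hm, rfl⟩ := Finset.mem_image.1 (Finsupp.mapDomain_support h)
    exact Or.inr ⟨m, rfl, by simpa [strip_apply] using hm⟩
  · split_ifs at h with heg
    · have := Finsupp.support_single_subset h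
      simp only [Finset.mem_singleton] at this
      subst this
      exact Or.inl ⟨rfl, heg, by simpa using h⟩
    · simp at h

omit [Fintype E] in
lemma weight_rotate_le {e g : E} {f : List E →₀ K} {T : Finset (List E)}
    (hnil : e = g → [] ∈ f.support → [] ∈ T) (hcons : ∀ m, e :: m ∈ f.support → e :: m ∈ T) :
    weight (rotate e g f) ≤ ∑ l ∈ T, (l.length + 1) := by
  refine sum_le_sum_length (fun l => if l = [] then [] else e :: l.dropLast) ?_ ?_ ?_
  · intro l hl
    rcases mem_support_rotate hl with ⟨rfl, h, h'⟩ | ⟨m, rfl, hm⟩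
    · simpa using hnil h h'
    · simpa using hcons m hm
  · intro l hl l' hl'
    rcases mem_support_rotate hl with ⟨rfl, -⟩ | ⟨m, rfl, -⟩ <;>
    rcases mem_support_rotate hl' with ⟨rfl, -⟩ | ⟨m', rfl, -⟩ <;> simp
  · intro l hl
    rcases mem_support_rotate hl with ⟨rfl, -⟩ | ⟨m, rfl, -⟩ <;> simp

/-- A nonzero combination of real paths lying in `C` with the smallest possible weight. -/
structure IsMinimal (C : Set A) (v w : W) (f : List E →₀ K) : Prop where
  mem : F.toElt v w f ∈ C
  ne_zero : F.toElt v w f ≠ 0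
  le : ∀ v' w', ∀ g : List E →₀ K, F.toElt v' w' g ∈ C → F.toElt v' w' g ≠ 0 →
    weight f ≤ weight g

section Minimal

variable {F} {C : Set A} {v w : W} {f : List E →₀ K}

lemma IsMinimal.pathElt_ne_zero (h : F.IsMinimal C v w f) {l : List E} (hl : l ∈ f.support) :
    F.P v * F.pathElt l * F.P w ≠ 0 := by
  intro h0
  have he : F.toElt v w (f.erase l) = F.toElt v w f := by
    conv_rhs => rw [← Finsupp.single_add_erase l f, map_add, toElt_single, h0, smul_zero, zero_add]
  have hle := h.le v w (f.erase l) (he ▸ h.mem) (he ▸ h.ne_zero)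
  have := sum_erase_lt_weight hl
  rw [weight, weight, Finsupp.support_erase] at *
  lia

lemma IsMinimal.src_eq (h : F.IsMinimal C v w f) {e : E} {l : List E}
    (hl : e :: l ∈ f.support) : D.src e = v := by
  by_contra hne
  apply h.pathElt_ne_zero hl
  rw [pathElt_cons, ← mul_assoc, F.P_mul_s_of_ne hne, zero_mul, zero_mul]

lemma IsMinimal.nil_mem (hleft : ∀ x, ∀ a ∈ C, x * a ∈ C) (h : F.IsMinimal C v w f) :
    [] ∈ f.support := by
  by_contra hnil
  have hne : f ≠ 0 := by rintro rfl; exact h.ne_zero (map_zero _)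
  obtain ⟨l, hl⟩ := Finsupp.support_nonempty_iff.2 hne
  obtain ⟨g, l, rfl⟩ := List.exists_cons_of_ne_nil (fun h0 => hnil (h0 ▸ hl) : l ≠ [])
  obtain ⟨e, he, hne'⟩ := F.exists_t_mul_ne_zero (a := F.toElt v w f) ⟨g, h.src_eq hl⟩
    (by rw [P_mul_toElt]; exact h.ne_zero)
  have heq : F.t e * F.toElt v w f = F.toElt (D.rng e) w (strip e f) := by
    rw [F.t_mul_toElt he, Finsupp.notMem_support_iff.1 hnil, zero_smul, add_zero]
  have hle := h.le _ _ (strip e f) (heq ▸ hleft _ _ h.mem) (heq ▸ hne')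
  have hlt : ∑ l ∈ (strip e f).support, (l.length + 1 + 1) ≤ weight f :=
    sum_le_sum_length (e :: ·) (fun l hl => by simpa [strip_apply] using hl)
      List.cons_injective.injOn (fun l _ => by simp)
  rw [Finset.sum_add_distrib, Finset.sum_const, smul_eq_mul, mul_one] at hlt
  have hcard : (strip e f).support.card = 0 := by
    rw [weight, weight] at *
    lia
  rw [Finset.card_eq_zero, Finsupp.support_eq_empty] at hcard
  rw [heq, hcard, map_zero] at hne'
  exact hne' rfl

lemma IsMinimal.eq (hleft : ∀ x, ∀ a ∈ C, x * a ∈ C) (h : F.IsMinimal C v w f) : v = w := by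
  by_contra hne
  apply h.pathElt_ne_zero (h.nil_mem hleft)
  simp [pathElt, F.P_mul_P, hne]

lemma IsMinimal.exists_rotate (hleft : ∀ x, ∀ a ∈ C, x * a ∈ C)
    (hright : ∀ x, ∀ a ∈ C, a * x ∈ C) (h : F.IsMinimal C v v f) {l₀ : List E}
    (hl₀ : l₀ ∈ f.support) (hl₀' : l₀ ≠ []) :
    ∃ e, D.src e = v ∧ F.P (D.rng e) ≠ 0 ∧ (∀ g, D.src g = v → g ≠ e → F.P (D.rng g) = 0) ∧
      (∀ l ∈ f.support, l = [] ∨ ∃ m, l = e :: m) ∧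
      F.IsMinimal C (D.rng e) (D.rng e) (rotate e e f) := by
  have hnil := h.nil_mem hleft
  have hv : ∃ e, D.src e = v := by
    obtain ⟨g, l, rfl⟩ := List.exists_cons_of_ne_nil hl₀'
    exact ⟨g, h.src_eq hl₀⟩
  obtain ⟨e, he, hne⟩ := F.exists_t_mul_ne_zero (a := F.toElt v v f) hv
    (by rw [P_mul_toElt]; exact h.ne_zero)
  obtain ⟨g, hg, hne⟩ := F.exists_mul_s_ne_zero (a := F.t e * F.toElt v v f) hv
    (by rw [mul_assoc, toElt_mul_P, if_pos rfl]; exact hne)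
  have hmem := hright (F.s g) _ (hleft (F.t e) _ h.mem)
  rw [F.t_mul_toElt_mul_s he hg] at hne hmem
  have hle := h.le _ _ _ hmem hne
  have heg : e = g := by
    by_contra heg
    refine (hle.trans (weight_rotate_le (T := f.support.erase []) (fun h => absurd h heg) ?_)).not_gt
      (sum_erase_lt_weight hnil)
    exact fun m hm => by simpa using hm
  subst heg
  have hstart : ∀ l ∈ f.support, l = [] ∨ ∃ m, l = e :: m := by
    intro l hl
    by_contra! hcon
    refine (hle.trans (weight_rotate_le (T := f.support.erase l) ?_ ?_)).not_gt
      (sum_erase_lt_weight hl)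
    · exact fun _ h => Finset.mem_erase.2 ⟨hcon.1.symm, h⟩
    · exact fun m h => Finset.mem_erase.2 ⟨(hcon.2 m).symm, h⟩
  refine ⟨e, he, ?_, ?_, hstart, hmem, hne, fun v' w' k hk hk' => ?_⟩
  · intro h0
    apply hne
    rw [← P_mul_toElt, h0, zero_mul]
  · intro k hk hke
    by_contra h0
    have heq : F.toElt (D.rng k) (D.rng k) (rotate k k f) = f [] • F.P (D.rng k) := by
      have : strip k f = 0 := by
        ext l
        rw [strip_apply, Finsupp.zero_apply]
        by_contra hl
        rcases hstart _ (Finsupp.mem_support_iff.2 hl) with h | ⟨m, h⟩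
        · simp at h
        · exact hke (List.cons.inj h).1
      rw [rotate, this, if_pos rfl, Finsupp.mapDomain_zero, zero_add, toElt_single]
      simp [pathElt, F.P_mul_P]
    have hmem' := hright (F.s k) _ (hleft (F.t k) _ h.mem)
    rw [F.t_mul_toElt_mul_s hk hk] at hmem'
    refine ((h.le _ _ _ hmem' ?_).trans (weight_rotate_le (T := f.support.erase l₀) ?_ ?_)).not_gt
      (sum_erase_lt_weight hl₀)
    · rw [heq]
      exact smul_ne_zero (Finsupp.mem_support_iff.1 hnil) h0
    · exact fun _ h => Finset.mem_erase.2 ⟨hl₀'.symm, h⟩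
    · intro m hm
      rcases hstart _ hm with h | ⟨m, h⟩
      · simp at h
      · exact absurd (List.cons.inj h).1 hke
  · exact (weight_rotate_le (fun _ h => h) (fun _ h => h)).trans (h.le _ _ k hk hk')

lemma IsMinimal.eq_walkList (hleft : ∀ x, ∀ a ∈ C, x * a ∈ C)
    (hright : ∀ x, ∀ a ∈ C, a * x ∈ C) {σ : W → E}
    (hσ : ∀ v e, D.src e = v → F.P (D.rng e) ≠ 0 →
      (∀ g, D.src g = v → g ≠ e → F.P (D.rng g) = 0) → σ v = e)
    (h : F.IsMinimal C v v f) {l m : List E} (hl : l ++ m ∈ f.support) :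
    l = walkList D σ v l.length := by
  induction l generalizing v f m with
  | nil => simp [walkList]
  | cons g l ih =>
    obtain ⟨e, he, hne, huniq, hstart, hmin⟩ := h.exists_rotate hleft hright hl (by simp)
    obtain rfl : g = e := by
      rcases hstart _ hl with h | ⟨m, h⟩
      · simp at h
      · exact (List.cons.inj h).1
    have hσv := hσ v g he hne huniq
    have hl' : l ++ (m ++ [g]) ∈ (rotate g g f).support := by
      rw [← List.append_assoc, Finsupp.mem_support_iff, rotate_apply_append]
      exact Finsupp.mem_support_iff.1 hl
    have hw : walkList D σ v 1 = [g] := by simp [walkList, hσv]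
    rw [List.length_cons, add_comm, walkList_add, hw, Function.iterate_one, Function.comp_apply,
      hσv, ← ih hmin hl']
    rfl

end Minimal

/-- The closed path at `v` following `σ`, or zero if no `σ` is given. -/
noncomputable def cycleElt (v : W) : Option (W → E) → A
  | none => 0
  | some σ => F.pathElt (walkList D σ v (Function.minimalPeriod (D.rng ∘ σ) v))

open Polynomial in
/-- A nonzero subset closed under multiplication contains a nonzero polynomial in a cycle. -/
theorem exists_aeval_cycleElt_mem (hF : F.Generates K) {N : Set A}
    (hleft : ∀ x, ∀ a ∈ N, x * a ∈ N) (hright : ∀ x, ∀ a ∈ N, a * x ∈ N)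
    (hN : ∃ a ∈ N, a ≠ 0) :
    ∃ v o, ∃ p : K[X], F.P v * aeval (F.cycleElt v o) p ∈ N ∧
      F.P v * aeval (F.cycleElt v o) p ≠ 0 := by
  obtain ⟨v, w, f, h⟩ : ∃ v w, ∃ f : List E →₀ K, F.IsMinimal N v w f := by
    obtain ⟨a, haN, ha⟩ := hN
    obtain ⟨x, y, v, w, f, hf, hne⟩ := F.exists_toElt_ne_zero hF ha
    let S : Set (W × W × (List E →₀ K)) :=
      {q | F.toElt q.1 q.2.1 q.2.2 ∈ N ∧ F.toElt q.1 q.2.1 q.2.2 ≠ 0}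
    have hS : S.Nonempty := ⟨(v, w, f), hf ▸ hright _ _ (hleft _ _ haN), hne⟩
    obtain ⟨q, hq, hmin⟩ := exists_minimalFor_of_wellFoundedLT (· ∈ S) (fun q => weight q.2.2) hS
    exact ⟨q.1, q.2.1, q.2.2, hq.1, hq.2, fun v' w' g h1 h2 =>
      le_of_not_gt fun hlt => hlt.not_ge (hmin (j := (v', w', g)) ⟨h1, h2⟩ hlt.le)⟩
  obtain rfl := h.eq hleft
  by_cases hs : ∃ l ∈ f.support, l ≠ []
  · obtain ⟨l₀, hl₀, hl₀'⟩ := hs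
    have : Nonempty E := ⟨l₀.head hl₀'⟩
    obtain ⟨σ, hσ⟩ : ∃ σ : W → E, ∀ v e, D.src e = v → F.P (D.rng e) ≠ 0 →
        (∀ g, D.src g = v → g ≠ e → F.P (D.rng g) = 0) → σ v = e := by
      have : ∀ v, ∃ e', ∀ e, D.src e = v → F.P (D.rng e) ≠ 0 →
        (∀ g, D.src g = v → g ≠ e → F.P (D.rng g) = 0) → e' = e := by
        intro v
        by_cases hv : ∃ e, D.src e = v ∧ F.P (D.rng e) ≠ 0
        · obtain ⟨e', he', hne'⟩ := hv
          refine ⟨e', fun e _ _ huniq => ?_⟩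
          by_contra hne
          exact hne' (huniq e' he' hne)
        · exact ⟨Classical.arbitrary E, fun e he hne _ => absurd ⟨e, he, hne⟩ hv⟩
      choose σ hσ using this
      exact ⟨σ, hσ⟩
    let p : K[X] := ∑ l ∈ f.support,
      C (f l) * X ^ (l.length / Function.minimalPeriod (D.rng ∘ σ) v)
    have hp : F.toElt v v f = F.P v * aeval (F.cycleElt v (some σ)) p := by
      rw [toElt, Finsupp.linearCombination_apply, Finsupp.sum, map_sum, Finset.mul_sum]
      refine Finset.sum_congr rfl fun l hl => ?_
      have hw : l = walkList D σ v l.length :=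
        h.eq_walkList hleft hright hσ (m := []) (by simpa using hl)
      have hne := h.pathElt_ne_zero hl
      have hper : (D.rng ∘ σ)^[l.length] v = v := by
        by_contra hper
        rw [hw, pathElt_walkList_mul_P, if_neg hper] at hne
        exact hne rfl
      obtain ⟨q, hq⟩ := Function.IsPeriodicPt.minimalPeriod_dvd hper
      have hmul : Function.minimalPeriod (D.rng ∘ σ) v *
          (l.length / Function.minimalPeriod (D.rng ∘ σ) v) = l.length :=
        Nat.mul_div_cancel' ⟨q, hq⟩
      have hl' : F.P v * F.pathElt l * F.P v = F.P v * F.cycleElt v (some σ) ^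
          (l.length / Function.minimalPeriod (D.rng ∘ σ) v) := by
        rw [cycleElt, ← pathElt_walkList_mul_period, hmul]
        conv_lhs => rw [hw, pathElt_walkList_mul_P, if_pos hper]
      rw [hl', map_mul, map_pow, aeval_X, aeval_C, ← Algebra.smul_def, mul_smul_comm]
    exact ⟨v, some σ, p, hp ▸ h.mem, hp ▸ h.ne_zero⟩
  · push Not at hs
    have hp : F.toElt v v f = F.P v * aeval (F.cycleElt v none) (C (f [])) := by
      have : f = Finsupp.single [] (f []) := by
        rw [← Finsupp.support_subset_singleton]
        exact fun l hl => by simpa using hs l hl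
      rw [this, toElt_single, aeval_C, Finsupp.single_eq_same, ← Algebra.commutes,
        ← Algebra.smul_def]
      simp [pathElt, F.P_mul_P]
    exact ⟨v, none, C (f []), hp ▸ h.mem, hp ▸ h.ne_zero⟩

lemma map_cycleElt {B : Type} [Ring B] (φ : A →+* B) (v : W) (o : Option (W → E)) :
    (F.map φ).cycleElt v o = φ (F.cycleElt v o) := by
  cases o with
  | none => simp [cycleElt]
  | some σ =>
    simp only [cycleElt, pathElt, map_list_prod, List.map_map]
    rfl

lemma Generates.map {B : Type} [Ring B] [Algebra K B] (hF : F.Generates K) (φ : A →ₐ[K] B)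
    (hφ : Function.Surjective φ) : (F.map (φ : A →+* B)).Generates K := by
  have h := congrArg (Subalgebra.map φ) hF
  rw [AlgHom.map_adjoin, Algebra.map_top, (AlgHom.range_eq_top φ).2 hφ, Set.image_union,
    Set.image_union, ← Set.range_comp, ← Set.range_comp, ← Set.range_comp] at h
  exact h

open Polynomial in
/-- The polynomials in `x` whose left multiple by `u` lies in a two-sided ideal. -/
noncomputable def polyIdeal (I : TwoSidedIdeal A) (u x : A) : Ideal K[X] where
  carrier := {p | u * aeval x p ∈ I}
  zero_mem' := by simp
  add_mem' hp hq := by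
    simp only [Set.mem_ofPred_eq, map_add, mul_add]
    exact I.add_mem hp hq
  smul_mem' q p hp := by
    simp only [Set.mem_ofPred_eq, smul_eq_mul, mul_comm q p, map_mul, ← mul_assoc]
    exact I.mul_mem_right _ _ hp

lemma le_of_polyIdeal_le (hF : F.Generates K) {I J : TwoSidedIdeal A} (hIJ : I ≤ J)
    (h : ∀ v o, polyIdeal (K := K) J (F.P v) (F.cycleElt v o) ≤
      polyIdeal I (F.P v) (F.cycleElt v o)) : J ≤ I := by
  intro a ha
  by_contra haI
  let φ : A →ₐ[K] I.ringCon.Quotient := I.ringCon.mkₐ K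
  have hφ : Function.Surjective φ := RingCon.mkₐ_surjective _
  have hker : ∀ x, φ x = 0 ↔ x ∈ I := fun x => by
    rw [TwoSidedIdeal.mem_iff]
    exact RingCon.eq I.ringCon
  obtain ⟨v, o, p, ⟨b, hb, hbp⟩, hne⟩ :=
    (F.map (φ : A →+* I.ringCon.Quotient)).exists_aeval_cycleElt_mem
      (Generates.map F hF φ hφ) (N := φ '' J)
      (by
        rintro x _ ⟨b, hb, rfl⟩
        obtain ⟨x, rfl⟩ := hφ x
        exact ⟨x * b, J.mul_mem_left _ _ hb, map_mul φ _ _⟩)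
      (by
        rintro x _ ⟨b, hb, rfl⟩
        obtain ⟨x, rfl⟩ := hφ x
        exact ⟨b * x, J.mul_mem_right _ _ hb, map_mul φ _ _⟩)
      ⟨φ a, ⟨a, ha, rfl⟩, fun h0 => haI ((hker a).1 h0)⟩
  have heq : (F.map (φ : A →+* I.ringCon.Quotient)).P v *
      Polynomial.aeval ((F.map (φ : A →+* I.ringCon.Quotient)).cycleElt v o) p =
      φ (F.P v * Polynomial.aeval (F.cycleElt v o) p) := by
    rw [map_cycleElt, map_mul, ← Polynomial.aeval_algHom_apply]
    rfl
  rw [heq] at hbp hne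
  refine hne ((hker _).2 (h v o ?_))
  have hsub : F.P v * Polynomial.aeval (F.cycleElt v o) p - b ∈ I := by
    rw [← hker, map_sub, hbp, sub_self]
  simpa using! J.add_mem (hIJ hsub) hb

/-- The ascending chain condition on two-sided ideals. -/
theorem monotone_stabilizes (hF : F.Generates K) (c : ℕ → TwoSidedIdeal A) (hc : Monotone c) :
    ∃ n, ∀ m, n ≤ m → c m = c n := by
  have hstab : ∀ i : W × Option (W → E), ∃ n, ∀ m, n ≤ m →
      polyIdeal (K := K) (c n) (F.P i.1) (F.cycleElt i.1 i.2) =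
        polyIdeal (c m) (F.P i.1) (F.cycleElt i.1 i.2) := fun i =>
    monotone_stabilizes_iff_noetherian.2 inferInstance
      ⟨fun n => polyIdeal (c n) (F.P i.1) (F.cycleElt i.1 i.2), fun _ _ hmn _ hp => hc hmn hp⟩
  choose n hn using hstab
  refine ⟨Finset.univ.sup n, fun m hm => (hc hm).antisymm' ?_⟩
  refine F.le_of_polyIdeal_le hF (hc hm) fun v o => ?_
  have hi : n (v, o) ≤ Finset.univ.sup n := Finset.le_sup (Finset.mem_univ _)
  rw [← hn (v, o) m (hi.trans hm), hn (v, o) _ hi]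

end

end LeavittFamily

section LeavittRelations

lemma vtx_mul_vtx [DecidableEq V] (v w : V) :
    vtx K G v * vtx K G w = if v = w then vtx K G v else 0 := by
  have h := RingQuot.mkAlgHom_rel K (LeavittRel.vv (K := K) (G := G) v w)
  rw [map_mul] at h
  rw [vtx, vtx, h]
  split_ifs <;> simp

lemma vtx_mul_re (e : Ed) : vtx K G (G.src e) * re K G e = re K G e := by
  simpa only [map_mul, vtx, re, ge] using RingQuot.mkAlgHom_rel K (LeavittRel.se (K := K) (G := G) e)

lemma re_mul_vtx (e : Ed) : re K G e * vtx K G (G.rng e) = re K G e := by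
  simpa only [map_mul, vtx, re, ge] using RingQuot.mkAlgHom_rel K (LeavittRel.er (K := K) (G := G) e)

lemma vtx_mul_ge (e : Ed) : vtx K G (G.rng e) * ge K G e = ge K G e := by
  simpa only [map_mul, vtx, re, ge] using RingQuot.mkAlgHom_rel K (LeavittRel.rg (K := K) (G := G) e)

lemma ge_mul_vtx (e : Ed) : ge K G e * vtx K G (G.src e) = ge K G e := by
  simpa only [map_mul, vtx, re, ge] using RingQuot.mkAlgHom_rel K (LeavittRel.gs (K := K) (G := G) e)

lemma ge_mul_re [DecidableEq Ed] (e f : Ed) :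
    ge K G e * re K G f = if e = f then vtx K G (G.rng e) else 0 := by
  have h := RingQuot.mkAlgHom_rel K (LeavittRel.gf (K := K) (G := G) e f)
  rw [map_mul] at h
  rw [re, ge, h]
  split_ifs <;> simp [vtx]

lemma vtx_eq_sum [DecidableEq V] [Fintype Ed] (v : V) (hv : ∃ e, G.src e = v) :
    vtx K G v = ∑ e with G.src e = v, re K G e * ge K G e := by
  have h := RingQuot.mkAlgHom_rel K
    (LeavittRel.ck (K := K) (G := G) v (Set.toFinite _) hv)
  rw [map_sum] at h
  simp only [map_mul] at h
  refine h.trans (Finset.sum_congr ?_ fun _ _ => rfl)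
  ext e
  simp

lemma adjoin_vtx_re_ge :
    Algebra.adjoin K (Set.range (vtx K G) ∪ Set.range (re K G) ∪ Set.range (ge K G)) = ⊤ := by
  rw [eq_top_iff, ← (AlgHom.range_eq_top (RingQuot.mkAlgHom K (LeavittRel K G))).2
    (RingQuot.mkAlgHom_surjective K _), ← Algebra.map_top, ← FreeAlgebra.adjoin_range_ι,
    AlgHom.map_adjoin]
  refine Algebra.adjoin_mono ?_
  rintro _ ⟨_, ⟨v | e | e, rfl⟩, rfl⟩
  · exact Or.inl (Or.inl ⟨v, rfl⟩)
  · exact Or.inl (Or.inr ⟨e, rfl⟩)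
  · exact Or.inr ⟨e, rfl⟩

/-- The graph with an isolated vertex added. -/
def DirGraph.addIsolated : DirGraph (Option V) Ed where
  src e := some (G.src e)
  rng e := some (G.rng e)

variable [Fintype V] [Fintype Ed] [DecidableEq V] [DecidableEq Ed]

omit [Fintype Ed] [DecidableEq Ed] in
lemma vtx_mul_sum_vtx (v : V) : vtx K G v * ∑ w, vtx K G w = vtx K G v := by
  simp [Finset.mul_sum, vtx_mul_vtx]

/-- The generators of `L_K(E)` with the complement of the sum of the vertices as a vertex. -/
def leavittFamily : LeavittFamily G.addIsolated (LPA K G) where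
  P o := o.elim (1 - ∑ v, vtx K G v) (vtx K G)
  s := re K G
  t := ge K G
  P_mul_P v w := by
    cases v <;> cases w <;>
      simp [vtx_mul_vtx, sub_mul, mul_sub, vtx_mul_sum_vtx, Finset.sum_mul]
  P_mul_s e := vtx_mul_re K G e
  s_mul_P e := re_mul_vtx K G e
  P_mul_t e := vtx_mul_ge K G e
  t_mul_P e := ge_mul_vtx K G e
  t_mul_s e f := ge_mul_re K G e f
  ck v hv := by
    obtain ⟨e, rfl⟩ := hv
    simpa [DirGraph.addIsolated] using vtx_eq_sum K G _ ⟨e, rfl⟩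
  sum_P := by simp

lemma leavittFamily_generates : (leavittFamily K G).Generates K := by
  rw [LeavittFamily.Generates, eq_top_iff, ← adjoin_vtx_re_ge K G]
  refine Algebra.adjoin_mono (Set.union_subset_union_left _ (Set.union_subset_union_left _ ?_))
  rintro _ ⟨v, rfl⟩
  exact ⟨some v, rfl⟩

end LeavittRelations

/-- the Leavitt path algebra of a finite graph is two-sided Noetherian. -/
theorem finite_graph_noetherian [Finite V] [Finite Ed] :
    ∀ c : ℕ → TwoSidedIdeal (LPA K G), Monotone c → ∃ n : ℕ, ∀ m : ℕ, n ≤ m → c m = c n := by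
  classical
  cases nonempty_fintype V
  cases nonempty_fintype Ed
  exact (leavittFamily K G).monotone_stabilizes (leavittFamily_generates K G)
end
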